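/- arXiv:math/0611525 — 5 statements merged into one kernel-verified Lean document; each statement's English description precedes it below -/
import Mathlib

section
/- Let R be a finite set and let B̃ be a real R×R matrix with all entries nonnegative. Then G_{B̃} is infinitely differentiable on (0,∞)^R, and for every Q ⊆ R and every l ∈ (0,∞)^R, the mixed partial derivative (∂^Q G_{B̃})(l) is a real number satisfying 0 ≤ (∂^Q G_{B̃})(l) ≤ (∂^Q H)(l), where H(l) = exp(Σ_{x,y∈R} B̃_{x,y} √(l_x l_y)) and ∂^Q denotes the mixed partial derivative taken once in each coordinate l_x with x ∈ Q. -/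
open MeasureTheory Finset

noncomputable section

/-- Partial derivative in direction `x` (complex-valued functions). -/
def pd {α : Type*} [Fintype α] [DecidableEq α] (x : α) (f : (α → ℝ) → ℂ) :
    (α → ℝ) → ℂ :=
  fun l => fderiv ℝ f l (Pi.single x 1)

/-- Mixed partial derivative `∂^Q f` (complex-valued functions). -/
def mpart {α : Type*} [Fintype α] [DecidableEq α] (Q : Finset α) (f : (α → ℝ) → ℂ) :
    (α → ℝ) → ℂ :=
  Q.toList.foldr pd f

/-- Partial derivative in direction `x` (real-valued functions). -/
def pdR {α : Type*} [Fintype α] [DecidableEq α] (x : α) (f : (α → ℝ) → ℝ) :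
    (α → ℝ) → ℝ :=
  fun l => fderiv ℝ f l (Pi.single x 1)

/-- Mixed partial derivative `∂^Q f` (real-valued functions). -/
def mpartR {α : Type*} [Fintype α] [DecidableEq α] (Q : Finset α) (f : (α → ℝ) → ℝ) :
    (α → ℝ) → ℝ :=
  Q.toList.foldr pdR f

/-- `G_M(l) = ∫_{[0,2π]^α} exp(Σ_{x,y} M_{x,y} √(l_x l_y) e^{i(θ_x−θ_y)}) ∏ dθ_x/(2π)`. -/
def GM {α : Type*} [Fintype α] [DecidableEq α] (M : Matrix α α ℝ) (l : α → ℝ) : ℂ :=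
  ((2 * Real.pi : ℂ) ^ (Fintype.card α))⁻¹ *
    ∫ θ in Set.univ.pi (fun _ : α => Set.Icc (0:ℝ) (2 * Real.pi)),
      Complex.exp (∑ x, ∑ y, (M x y : ℂ) * (Real.sqrt (l x * l y) : ℂ) *
        Complex.exp (Complex.I * ((θ x : ℂ) - (θ y : ℂ))))

section Helpers

set_option linter.unusedSectionVars false

open scoped ContDiff ComplexOrder

variable {R : Type*} [Fintype R] [DecidableEq R]

/-- The open positive orthant. -/
def posO (R : Type*) : Set (R → ℝ) := Set.univ.pi fun _ : R => Set.Ioi (0:ℝ)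

/-- The box `[0,2π]^R`. -/
def boxO (R : Type*) : Set (R → ℝ) := Set.univ.pi fun _ : R => Set.Icc (0:ℝ) (2 * Real.pi)


lemma posO_isOpen : IsOpen (posO R) :=
  isOpen_set_pi Set.finite_univ (fun _ _ => isOpen_Ioi)

lemma boxO_isCompact : IsCompact (boxO R) :=
  isCompact_univ_pi (fun _ => isCompact_Icc)

lemma mem_posO {l : R → ℝ} : l ∈ posO R ↔ ∀ x, 0 < l x := by
  simp [posO]

/-- Smoothness of an integral over a compact set depending on a parameter. -/
lemma contDiffOn_setIntegral {s K : Set (R → ℝ)} (hs : IsOpen s) (hK : IsCompact K)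
    {f : (R → ℝ) → (R → ℝ) → ℂ}
    (hf : ContDiffOn ℝ (⊤ : ℕ∞) (fun q : (R → ℝ) × (R → ℝ) => f q.1 q.2) (s ×ˢ Set.univ)) :
    ContDiffOn ℝ (⊤ : ℕ∞) (fun l => ∫ θ in K, f l θ) s := by
  obtain ⟨r, hr0, hr⟩ : ∃ r : ℝ, 0 < r ∧ K ⊆ Metric.closedBall 0 r := by
    obtain ⟨r, hr⟩ := hK.isBounded.subset_closedBall 0
    exact ⟨max r 1, by positivity, hr.trans (Metric.closedBall_subset_closedBall (le_max_left _ _))⟩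
  let χ : ContDiffBump (0 : R → ℝ) := ⟨r, r + 1, hr0, by linarith⟩
  have key := contDiffOn_convolution_right_with_param (𝕜 := ℝ) (μ := volume)
    (f := K.indicator (fun _ => (1:ℝ))) (n := ⊤)
    (ContinuousLinearMap.lsmul ℝ ℝ : ℝ →L[ℝ] ℂ →L[ℝ] ℂ)
    (g := fun (l : R → ℝ) (u : R → ℝ) => (χ u) • f l (-u)) (s := s)
    (k := Metric.closedBall 0 (r + 1)) hs (isCompact_closedBall _ _) ?_ ?_ ?_
  · have h2 : ContDiffOn ℝ (⊤ : ℕ∞) (fun l : R → ℝ => (l, (0 : R → ℝ))) s :=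
      (contDiff_id.prodMk contDiff_const).contDiffOn
    have h3 := key.comp h2 (fun l hl => ⟨hl, Set.mem_univ _⟩)
    refine h3.congr fun l hl => ?_
    simp only [Function.comp, convolution_def, ContinuousLinearMap.lsmul_apply]
    rw [← integral_indicator hK.measurableSet]
    congr 1
    ext θ
    by_cases hθ : θ ∈ K
    · have h1 : χ (0 - θ) = 1 := by
        apply χ.one_of_mem_closedBall
        have := hr hθ
        simpa using this
      rw [Set.indicator_of_mem hθ, Set.indicator_of_mem hθ, h1]
      simp
    · simp [hθ]
  · intro p x _ hx
    have : χ x = 0 := by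
      apply χ.zero_of_le_dist
      simp only [Metric.mem_closedBall, not_le] at hx
      exact hx.le
    simp [this]
  · apply Integrable.locallyIntegrable
    rw [integrable_indicator_iff hK.measurableSet]
    exact integrableOn_const hK.measure_lt_top.ne
  · have h1 : ContDiff ℝ (⊤ : ℕ∞) (fun q : (R → ℝ) × (R → ℝ) => χ q.2) :=
      χ.contDiff.comp contDiff_snd
    have h2 : ContDiff ℝ (⊤ : ℕ∞) (fun q : (R → ℝ) × (R → ℝ) => (q.1, -q.2)) :=
      contDiff_fst.prodMk contDiff_snd.neg
    exact h1.contDiffOn.smul (hf.comp h2.contDiffOn (fun q hq => ⟨hq.1, Set.mem_univ _⟩))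

/-- Differentiation under the integral sign. -/
lemma pd_setIntegral {s K : Set (R → ℝ)} (hs : IsOpen s) (hK : IsCompact K)
    {f : (R → ℝ) → (R → ℝ) → ℂ}
    (hf : ContDiffOn ℝ (⊤ : ℕ∞) (fun q : (R → ℝ) × (R → ℝ) => f q.1 q.2) (s ×ˢ Set.univ))
    (x : R) {l : R → ℝ} (hl : l ∈ s) :
    pd x (fun l => ∫ θ in K, f l θ) l = ∫ θ in K, pd x (fun l => f l θ) l := by
  set F : (R → ℝ) × (R → ℝ) → ℂ := fun q => f q.1 q.2 with hF
  have ho : IsOpen (s ×ˢ (Set.univ : Set (R → ℝ))) := hs.prod isOpen_univ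
  have hc : ContinuousOn (fderiv ℝ F) (s ×ˢ Set.univ) :=
    hf.continuousOn_fderiv_of_isOpen ho (by simp)
  let F' : (R → ℝ) → (R → ℝ) → ((R → ℝ) →L[ℝ] ℂ) := fun l θ =>
    (fderiv ℝ F (l, θ)).comp (ContinuousLinearMap.inl ℝ (R → ℝ) (R → ℝ))
  have hd : ∀ l ∈ s, ∀ θ, HasFDerivAt (fun l => f l θ) (F' l θ) l := by
    intro l hl θ
    have h1 : HasFDerivAt F (fderiv ℝ F (l, θ)) (l, θ) :=
      ((hf.differentiableOn (by simp)).differentiableAt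
        (ho.mem_nhds ⟨hl, Set.mem_univ _⟩)).hasFDerivAt
    exact HasFDerivAt.comp (g := F) (f := fun e => (e, θ)) l h1 (hasFDerivAt_prodMk_left l θ)
  have hF'c : ContinuousOn (fun q : (R → ℝ) × (R → ℝ) => F' q.1 q.2) (s ×ˢ Set.univ) :=
    hc.clm_comp continuousOn_const
  obtain ⟨ε, hε, hball⟩ := Metric.nhds_basis_closedBall.mem_iff.1 (hs.mem_nhds hl)
  obtain ⟨C, hC⟩ := ((isCompact_closedBall l ε).prod hK).exists_bound_of_continuousOn
    (hF'c.mono (Set.prod_mono hball (Set.subset_univ K)))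
  have hfc : ∀ l ∈ s, Continuous (f l) := fun l hl =>
    hf.continuousOn.comp_continuous (Continuous.prodMk_right l) (fun θ => ⟨hl, Set.mem_univ _⟩)
  have hF'c1 : Continuous (F' l) :=
    hF'c.comp_continuous (Continuous.prodMk_right l) (fun θ => ⟨hl, Set.mem_univ _⟩)
  have key := hasFDerivAt_integral_of_dominated_of_fderiv_le (𝕜 := ℝ) (μ := volume.restrict K)
    (F := f) (F' := F') (x₀ := l) (bound := fun _ => C)
    (Metric.closedBall_mem_nhds l hε)
    (by filter_upwards [hs.mem_nhds hl] with l' hl' using (hfc l' hl').aestronglyMeasurable)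
    ((hfc l hl).continuousOn.integrableOn_compact hK)
    hF'c1.aestronglyMeasurable
    ((ae_restrict_iff' hK.measurableSet).2 (Filter.Eventually.of_forall
      (fun θ hθ l' hl' => hC (l', θ) ⟨hl', hθ⟩)))
    (integrableOn_const hK.measure_lt_top.ne)
    (Filter.Eventually.of_forall (fun θ l' hl' => hd l' (hball hl') θ))
  unfold pd
  rw [key.fderiv, ContinuousLinearMap.integral_apply]
  · congr 1
    ext θ
    rw [(hd l hl θ).fderiv]
  · exact hF'c1.continuousOn.integrableOn_compact hK

/-- A positive monomial. -/
def mon (c : ℝ) (m n : R → ℤ) (l θ : R → ℝ) : ℂ :=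
  c * Complex.exp (∑ x, (((m x : ℂ) / 2) * (Real.log (l x) : ℂ) + Complex.I * (n x) * (θ x)))

lemma mon_mul (c c' : ℝ) (m n m' n' : R → ℤ) :
    mon c m n * mon c' m' n' = mon (c * c') (m + m') (n + n') := by
  ext l θ
  simp only [mon, Pi.mul_apply]
  rw [mul_mul_mul_comm, ← Complex.exp_add, ← Finset.sum_add_distrib]
  push_cast
  congr 2
  apply Finset.sum_congr rfl
  intro x _
  simp only [Pi.add_apply]
  push_cast
  ring

/-- Monomials with nonnegative exponents outside `s`. -/
def monS (s : Set R) : Submonoid ((R → ℝ) → (R → ℝ) → ℂ) where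
  carrier := {f | ∃ (c : ℝ) (m n : R → ℤ), 0 ≤ c ∧ (∀ x, x ∉ s → 0 ≤ m x) ∧ f = mon c m n}
  one_mem' := ⟨1, 0, 0, zero_le_one, fun _ _ => le_rfl, by ext l θ; simp [mon]⟩
  mul_mem' := by
    rintro _ _ ⟨c, m, n, hc, hm, rfl⟩ ⟨c', m', n', hc', hm', rfl⟩
    exact ⟨c * c', m + m', n + n', mul_nonneg hc hc',
      fun x hx => add_nonneg (hm x hx) (hm' x hx), mon_mul _ _ _ _ _ _⟩

/-- Positive combinations of monomials with nonnegative exponents outside `s`. -/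
def posT (s : Set R) : Subsemiring ((R → ℝ) → (R → ℝ) → ℂ) := (monS s).subsemiringClosure

lemma mon_mem {s : Set R} {c : ℝ} {m n : R → ℤ} (hc : 0 ≤ c) (hm : ∀ x, x ∉ s → 0 ≤ m x) :
    mon c m n ∈ posT s := by
  rw [posT, Submonoid.subsemiringClosure_mem]
  exact AddSubmonoid.subset_closure ⟨c, m, n, hc, hm, rfl⟩

lemma posT_induction {s : Set R} {p : ((R → ℝ) → (R → ℝ) → ℂ) → Prop}
    (hmon : ∀ (c : ℝ) (m n : R → ℤ), 0 ≤ c → (∀ x, x ∉ s → 0 ≤ m x) → p (mon c m n))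
    (hzero : p 0) (hadd : ∀ f g, f ∈ posT s → g ∈ posT s → p f → p g → p (f + g))
    {f : (R → ℝ) → (R → ℝ) → ℂ} (hf : f ∈ posT s) : p f := by
  rw [posT, Submonoid.subsemiringClosure_mem] at hf
  induction hf using AddSubmonoid.closure_induction with
  | mem f hf =>
    obtain ⟨c, m, n, hc, hm, rfl⟩ := hf
    exact hmon c m n hc hm
  | zero => exact hzero
  | add f g hf hg h1 h2 =>
    rw [← Submonoid.subsemiringClosure_mem] at hf hg
    exact hadd f g hf hg h1 h2

lemma posT_mono {s s' : Set R} (h : s ⊆ s') {f : (R → ℝ) → (R → ℝ) → ℂ} (hf : f ∈ posT s) :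
    f ∈ posT s' := by
  refine posT_induction (fun c m n hc hm => mon_mem hc (fun x hx => hm x (fun h' => hx (h h'))))
    (zero_mem _) (fun f g _ _ h1 h2 => add_mem h1 h2) hf

lemma mon_contDiffOn (c : ℝ) (m n : R → ℤ) :
    ContDiffOn ℝ (⊤ : ℕ∞) (fun q : (R → ℝ) × (R → ℝ) => mon c m n q.1 q.2)
      (posO R ×ˢ Set.univ) := by
  unfold mon
  refine contDiffOn_const.mul (ContDiffOn.cexp (ContDiffOn.sum fun x _ => ?_))
  refine (contDiffOn_const.mul ?_).add (contDiffOn_const.mul ?_)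
  · refine Complex.ofRealCLM.contDiff.comp_contDiffOn (ContDiffOn.log ?_ ?_)
    · fun_prop
    · intro q hq
      exact (mem_posO.1 hq.1 x).ne'
  · refine Complex.ofRealCLM.contDiff.comp_contDiffOn ?_
    fun_prop

lemma posT_contDiffOn {s : Set R} {f : (R → ℝ) → (R → ℝ) → ℂ} (hf : f ∈ posT s) :
    ContDiffOn ℝ (⊤ : ℕ∞) (fun q : (R → ℝ) × (R → ℝ) => f q.1 q.2) (posO R ×ˢ Set.univ) := by
  refine posT_induction (p := fun f => ContDiffOn ℝ (⊤ : ℕ∞)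
      (fun q : (R → ℝ) × (R → ℝ) => f q.1 q.2) (posO R ×ˢ Set.univ))
    (fun c m n hc hm => mon_contDiffOn c m n) contDiffOn_const
    (fun f g _ _ h1 h2 => h1.add h2) hf

lemma slice_contDiffOn {f : (R → ℝ) → (R → ℝ) → ℂ}
    (hf : ContDiffOn ℝ (⊤ : ℕ∞) (fun q : (R → ℝ) × (R → ℝ) => f q.1 q.2)
      (posO R ×ˢ Set.univ)) (θ : R → ℝ) :
    ContDiffOn ℝ (⊤ : ℕ∞) (fun l => f l θ) (posO R) :=
  hf.comp (contDiff_id.prodMk contDiff_const).contDiffOn (fun _ hl => ⟨hl, Set.mem_univ _⟩)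

lemma slice_differentiableAt {f : (R → ℝ) → (R → ℝ) → ℂ}
    (hf : ContDiffOn ℝ (⊤ : ℕ∞) (fun q : (R → ℝ) × (R → ℝ) => f q.1 q.2)
      (posO R ×ˢ Set.univ)) (θ : R → ℝ) {l : R → ℝ} (hl : l ∈ posO R) :
    DifferentiableAt ℝ (fun l => f l θ) l :=
  ((slice_contDiffOn hf θ).differentiableOn (by simp)).differentiableAt (posO_isOpen.mem_nhds hl)

lemma pd_mon (c : ℝ) (m n : R → ℤ) (x : R) {l : R → ℝ} (hl : l ∈ posO R) (θ : R → ℝ) :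
    pd x (fun l => mon c m n l θ) l = mon (c * (m x / 2)) (m - Pi.single x 2) n l θ := by
  have hl' := mem_posO.1 hl
  have h1 : ∀ y, HasFDerivAt (fun l : R → ℝ => ((m y : ℂ) / 2) * (Real.log (l y) : ℂ) +
      Complex.I * (n y) * (θ y))
      (((m y : ℂ) / 2) • (Complex.ofRealCLM.comp
        ((l y)⁻¹ • (ContinuousLinearMap.proj y : (R → ℝ) →L[ℝ] ℝ)))) l := by
    intro y
    have h0 : HasFDerivAt (fun l : R → ℝ => Real.log (l y))
        ((l y)⁻¹ • (ContinuousLinearMap.proj y : (R → ℝ) →L[ℝ] ℝ)) l :=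
      (hasFDerivAt_apply y l).log (hl' y).ne'
    exact ((Complex.ofRealCLM.hasFDerivAt.comp l h0).const_mul _).add_const _
  have h2 := ((HasFDerivAt.fun_sum (u := Finset.univ) fun y _ => h1 y).cexp).const_mul (c : ℂ)
  unfold pd mon
  rw [h2.fderiv]
  have h3 : ∑ y, ((((m - Pi.single x 2 : R → ℤ) y : ℤ) : ℂ) / 2 * (Real.log (l y) : ℂ) +
      Complex.I * (n y) * (θ y)) = (∑ y, ((m y : ℂ) / 2 * (Real.log (l y) : ℂ) +
      Complex.I * (n y) * (θ y))) - (Real.log (l x) : ℂ) := by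
    rw [eq_sub_iff_add_eq, ← Finset.sum_erase_add _ _ (Finset.mem_univ x),
      ← Finset.sum_erase_add _ _ (Finset.mem_univ x), add_assoc]
    congr 1
    · refine Finset.sum_congr rfl fun y hy => ?_
      simp [Pi.single_eq_of_ne (Finset.ne_of_mem_erase hy)]
    · simp; ring
  rw [h3, Complex.exp_sub, ← Complex.ofReal_exp, Real.exp_log (hl' x)]
  have h4 : (∑ i, ((m i : ℂ) / 2) • (Complex.ofRealCLM.comp
        ((l i)⁻¹ • (ContinuousLinearMap.proj i : (R → ℝ) →L[ℝ] ℝ)))) (Pi.single x 1) =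
      (m x : ℂ) / 2 * ((l x : ℂ))⁻¹ := by
    rw [_root_.sum_apply, Finset.sum_eq_single x]
    · simp
    · intro y _ hy
      simp [Pi.single_eq_of_ne hy]
    · simp
  rw [_root_.smul_apply, _root_.smul_apply, h4]
  simp only [smul_eq_mul]
  push_cast
  ring

lemma posT_deriv {s : Set R} {f : (R → ℝ) → (R → ℝ) → ℂ} (hf : f ∈ posT s) {x : R}
    (hx : x ∉ s) : ∃ f' ∈ posT (insert x s), ∀ l ∈ posO R, ∀ θ,
      pd x (fun l => f l θ) l = f' l θ := by
  refine posT_induction (p := fun f => ∃ f' ∈ posT (insert x s), ∀ l ∈ posO R, ∀ θ,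
      pd x (fun l => f l θ) l = f' l θ)
    (fun c m n hc hm => ?_) ?_ (fun f g hf hg h1 h2 => ?_) hf
  · refine ⟨mon (c * (m x / 2)) (m - Pi.single x 2) n, mon_mem ?_ ?_,
      fun l hl θ => pd_mon c m n x hl θ⟩
    · have : (0:ℝ) ≤ m x := by exact_mod_cast hm x hx
      positivity
    · intro y hy
      simp only [Set.mem_insert_iff, not_or] at hy
      simpa [Pi.single_eq_of_ne hy.1] using hm y hy.2
  · exact ⟨0, zero_mem _, fun l hl θ => by simp [pd]⟩
  · obtain ⟨f', hf', h1⟩ := h1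
    obtain ⟨g', hg', h2⟩ := h2
    refine ⟨f' + g', add_mem hf' hg', fun l hl θ => ?_⟩
    have e : pd x (fun l => (f + g) l θ) l = pd x (fun l => f l θ) l + pd x (fun l => g l θ) l := by
      unfold pd
      have := fderiv_fun_add (slice_differentiableAt (posT_contDiffOn hf) θ hl)
        (slice_differentiableAt (posT_contDiffOn hg) θ hl)
      simp only [Pi.add_apply]
      rw [this]; rfl
    rw [e, h1 l hl, h2 l hl]; rfl

/-- Average over the torus. -/
def avO (φ : (R → ℝ) → ℂ) : ℂ :=
  ((2 * Real.pi : ℂ) ^ (Fintype.card R))⁻¹ * ∫ θ in boxO R, φ θ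

lemma int_char (n : ℤ) : ∫ t in Set.Icc (0:ℝ) (2 * Real.pi), Complex.exp (Complex.I * n * t)
    = if n = 0 then (2 * Real.pi : ℂ) else 0 := by
  rw [integral_Icc_eq_integral_Ioc, ← intervalIntegral.integral_of_le (by positivity)]
  split_ifs with h
  · simp [h]
  · have hc : Complex.I * (n : ℂ) ≠ 0 := by simp [h]
    rw [integral_exp_mul_complex hc]
    have : Complex.exp (Complex.I * n * ((2 * Real.pi : ℝ) : ℂ)) = 1 := by
      rw [Complex.exp_eq_one_iff]
      exact ⟨n, by push_cast; ring⟩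
    rw [this]; simp

lemma int_box_char (n : R → ℤ) :
    ∫ θ in boxO R, Complex.exp (∑ x, Complex.I * (n x) * (θ x))
      = ∏ x, if n x = 0 then (2 * Real.pi : ℂ) else 0 := by
  simp_rw [Complex.exp_sum]
  rw [boxO, volume_pi, Measure.restrict_pi_pi]
  rw [integral_fintype_prod_eq_prod (fun x (t : ℝ) => Complex.exp (Complex.I * (n x) * t))]
  exact Finset.prod_congr rfl fun x _ => int_char (n x)

lemma av_mon {c : ℝ} (hc : 0 ≤ c) (m n : R → ℤ) (l : R → ℝ) :
    0 ≤ avO (mon c m n l) ∧ avO (mon c m n l) ≤ mon c m n l 0 := by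
  have hr : mon c m n l 0 = ((c * Real.exp (∑ x, (m x / 2) * Real.log (l x)) : ℝ) : ℂ) := by
    simp [mon]
  have h0 : (0 : ℂ) ≤ mon c m n l 0 := by
    rw [hr]
    exact_mod_cast (by positivity)
  have he : avO (mon c m n l) = mon c m n l 0 * (((2 * Real.pi : ℂ) ^ (Fintype.card R))⁻¹ *
      ∏ x, if n x = 0 then (2 * Real.pi : ℂ) else 0) := by
    rw [← int_box_char, avO]
    have : ∀ θ, mon c m n l θ = mon c m n l 0 * Complex.exp (∑ x, Complex.I * (n x) * (θ x)) := by
      intro θ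
      simp [mon, Finset.sum_add_distrib, Complex.exp_add, mul_assoc]
    rw [integral_congr_ae (Filter.Eventually.of_forall this), integral_const_mul]
    ring
  rw [he]
  by_cases h : ∀ x, n x = 0
  · have h2 : ((2 * Real.pi : ℂ) ^ (Fintype.card R)) ≠ 0 :=
      pow_ne_zero _ (by simp [Real.pi_ne_zero])
    simp only [h, if_true, Finset.prod_const, Finset.card_univ]
    rw [inv_mul_cancel₀ h2, mul_one]
    exact ⟨h0, le_rfl⟩
  · push Not at h
    obtain ⟨x, hx⟩ := h
    rw [Finset.prod_eq_zero (Finset.mem_univ x) (by simp [hx])]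
    rw [mul_zero, mul_zero]
    exact ⟨le_rfl, h0⟩

lemma posT_continuous {s : Set R} {f : (R → ℝ) → (R → ℝ) → ℂ} (hf : f ∈ posT s) (l : R → ℝ) :
    Continuous (f l) := by
  refine posT_induction (p := fun f => Continuous (f l)) (fun c m n hc hm => ?_) continuous_const
    (fun f g _ _ h1 h2 => h1.add h2) hf
  unfold mon
  fun_prop

lemma posT_av {s : Set R} {f : (R → ℝ) → (R → ℝ) → ℂ} (hf : f ∈ posT s) (l : R → ℝ) :
    0 ≤ avO (f l) ∧ avO (f l) ≤ f l 0 := by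
  refine posT_induction (p := fun f => 0 ≤ avO (f l) ∧ avO (f l) ≤ f l 0)
    (fun c m n hc hm => av_mon hc m n l) (by simp [avO]) (fun f g hf hg h1 h2 => ?_) hf
  have : avO ((f + g) l) = avO (f l) + avO (g l) := by
    unfold avO
    rw [← mul_add, ← integral_add]
    · rfl
    · exact (posT_continuous hf l).continuousOn.integrableOn_compact boxO_isCompact
    · exact (posT_continuous hg l).continuousOn.integrableOn_compact boxO_isCompact
  rw [this]
  exact ⟨add_nonneg h1.1 h2.1, add_le_add h1.2 h2.2⟩

lemma posT_exp_av {s : Set R} {f E : (R → ℝ) → (R → ℝ) → ℂ} (hf : f ∈ posT s) (hE : E ∈ posT s)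
    (l : R → ℝ) : 0 ≤ avO (fun θ => f l θ * Complex.exp (E l θ)) ∧
      avO (fun θ => f l θ * Complex.exp (E l θ)) ≤ f l 0 * Complex.exp (E l 0) := by
  let t : ℕ → (R → ℝ) → (R → ℝ) → ℂ := fun k => mon ((k.factorial : ℝ)⁻¹) 0 0 * (f * E ^ k)
  have ht : ∀ k, t k ∈ posT s := fun k =>
    mul_mem (mon_mem (by positivity) (fun _ _ => le_rfl)) (mul_mem hf (pow_mem hE k))
  have ht' : ∀ k θ, t k l θ = f l θ * ((k.factorial : ℂ)⁻¹ * E l θ ^ k) := by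
    intro k θ
    simp [t, mon]; ring
  have hs : ∀ θ, HasSum (fun k => t k l θ) (f l θ * Complex.exp (E l θ)) := by
    intro θ
    simp_rw [ht']
    apply HasSum.mul_left
    have := NormedSpace.exp_series_hasSum_exp' (𝕂 := ℂ) (E l θ)
    rw [← Complex.exp_eq_exp_ℂ] at this
    simpa using this
  obtain ⟨A, hA⟩ := boxO_isCompact.exists_bound_of_continuousOn
    (posT_continuous hf l).continuousOn
  obtain ⟨B, hB⟩ := boxO_isCompact.exists_bound_of_continuousOn
    (posT_continuous hE l).continuousOn
  have hsumB : Summable (fun k : ℕ => A * ((k.factorial : ℝ)⁻¹ * B ^ k)) := by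
    apply Summable.mul_left
    have := Real.summable_pow_div_factorial B
    simpa [div_eq_inv_mul] using this
  have hint : HasSum (fun k => ∫ θ in boxO R, t k l θ)
      (∫ θ in boxO R, f l θ * Complex.exp (E l θ)) := by
    refine hasSum_integral_of_dominated_convergence
      (fun k _ => A * ((k.factorial : ℝ)⁻¹ * B ^ k))
      (fun k => (posT_continuous (ht k) l).aestronglyMeasurable) (fun k => ?_)
      (Filter.Eventually.of_forall fun _ => hsumB)
      (integrableOn_const boxO_isCompact.measure_lt_top.ne)
      (Filter.Eventually.of_forall hs)
    refine (ae_restrict_iff' boxO_isCompact.measurableSet).2 (Filter.Eventually.of_forall ?_)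
    intro θ hθ
    rw [ht']
    have h1 := hA θ hθ
    have h2 := hB θ hθ
    have hA0 : 0 ≤ A := (norm_nonneg _).trans h1
    simp only [norm_mul, norm_inv, norm_pow, Complex.norm_natCast]
    gcongr
  have hav : HasSum (fun k => avO (t k l)) (avO (fun θ => f l θ * Complex.exp (E l θ))) :=
    hint.mul_left _
  exact ⟨hav.nonneg fun k => (posT_av (ht k) l).1,
    hasSum_le (fun k => (posT_av (ht k) l).2) hav (hs 0)⟩

/-- The exponent. -/
def expoE (M : Matrix R R ℝ) : (R → ℝ) → (R → ℝ) → ℂ :=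
  ∑ x, ∑ y, mon (M x y) (Pi.single x 1 + Pi.single y 1) (Pi.single x 1 - Pi.single y 1)

lemma expoE_mem {M : Matrix R R ℝ} (hM : ∀ x y, 0 ≤ M x y) (s : Set R) : expoE M ∈ posT s := by
  refine sum_mem fun x _ => sum_mem fun y _ => mon_mem (hM x y) fun z _ => ?_
  have h : ∀ w : R, (0:ℤ) ≤ (Pi.single w 1 : R → ℤ) z := fun w => by
    by_cases h : z = w
    · subst h; simp
    · simp [Pi.single_eq_of_ne h]
  exact add_nonneg (h x) (h y)

lemma expoE_apply (M : Matrix R R ℝ) {l : R → ℝ} (hl : l ∈ posO R) (θ : R → ℝ) :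
    expoE M l θ = ∑ x, ∑ y, (M x y : ℂ) * (Real.sqrt (l x * l y) : ℂ) *
        Complex.exp (Complex.I * ((θ x : ℂ) - (θ y : ℂ))) := by
  have hl' := mem_posO.1 hl
  simp only [expoE, Finset.sum_apply]
  refine Finset.sum_congr rfl fun x _ => Finset.sum_congr rfl fun y _ => ?_
  have hsq : Real.sqrt (l x * l y) = Real.exp (Real.log (l x) / 2 + Real.log (l y) / 2) := by
    rw [Real.sqrt_eq_rpow, Real.rpow_def_of_pos (mul_pos (hl' x) (hl' y)),
      Real.log_mul (hl' x).ne' (hl' y).ne']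
    congr 1; ring
  rw [hsq, mon, Complex.ofReal_exp, mul_assoc, ← Complex.exp_add]
  congr 2
  have hsingle : ∀ (w : R) (g : R → ℂ), ∑ z, (((Pi.single w 1 : R → ℤ) z : ℤ) : ℂ) * g z = g w := by
    intro w g
    rw [Finset.sum_eq_single w]
    · simp
    · intro z _ hz
      simp [Pi.single_eq_of_ne hz]
    · simp
  have e : ∀ z, ((((Pi.single x 1 + Pi.single y 1 : R → ℤ) z : ℤ) : ℂ) / 2 * (Real.log (l z) : ℂ) +
      Complex.I * (((Pi.single x 1 - Pi.single y 1 : R → ℤ) z : ℤ) : ℂ) * (θ z)) =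
      (((Pi.single x 1 : R → ℤ) z : ℤ) : ℂ) * ((Real.log (l z) : ℂ) / 2 + Complex.I * θ z) +
      (((Pi.single y 1 : R → ℤ) z : ℤ) : ℂ) * ((Real.log (l z) : ℂ) / 2 - Complex.I * θ z) := by
    intro z
    simp only [Pi.add_apply, Pi.sub_apply]
    push_cast
    ring
  simp_rw [e]
  rw [Finset.sum_add_distrib, hsingle, hsingle]
  push_cast
  ring

lemma fexp_contDiffOn {s : Set R} {f E : (R → ℝ) → (R → ℝ) → ℂ} (hf : f ∈ posT s)
    (hE : E ∈ posT s) :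
    ContDiffOn ℝ (⊤ : ℕ∞) (fun q : (R → ℝ) × (R → ℝ) => f q.1 q.2 * Complex.exp (E q.1 q.2))
      (posO R ×ˢ Set.univ) :=
  (posT_contDiffOn hf).mul (posT_contDiffOn hE).cexp

lemma avO_contDiffOn {f : (R → ℝ) → (R → ℝ) → ℂ}
    (hf : ContDiffOn ℝ (⊤ : ℕ∞) (fun q : (R → ℝ) × (R → ℝ) => f q.1 q.2)
      (posO R ×ˢ Set.univ)) : ContDiffOn ℝ (⊤ : ℕ∞) (fun l => avO (f l)) (posO R) :=
  contDiffOn_const.mul (contDiffOn_setIntegral posO_isOpen boxO_isCompact hf)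

lemma pd_avO {f : (R → ℝ) → (R → ℝ) → ℂ}
    (hf : ContDiffOn ℝ (⊤ : ℕ∞) (fun q : (R → ℝ) × (R → ℝ) => f q.1 q.2)
      (posO R ×ˢ Set.univ)) (x : R) {l : R → ℝ} (hl : l ∈ posO R) :
    pd x (fun l => avO (f l)) l = avO (fun θ => pd x (fun l => f l θ) l) := by
  have hd : DifferentiableAt ℝ (fun l => ∫ θ in boxO R, f l θ) l :=
    ((contDiffOn_setIntegral posO_isOpen boxO_isCompact hf).differentiableOn
      (by simp)).differentiableAt (posO_isOpen.mem_nhds hl)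
  rw [avO, ← pd_setIntegral posO_isOpen boxO_isCompact hf x hl]
  unfold pd avO
  rw [fderiv_const_mul hd]
  rfl

lemma pd_fexp {s : Set R} {f E : (R → ℝ) → (R → ℝ) → ℂ} (hf : f ∈ posT s)
    (hE : E ∈ posT s) (x : R) {l : R → ℝ} (hl : l ∈ posO R) (θ : R → ℝ) :
    pd x (fun l => f l θ * Complex.exp (E l θ)) l =
      (pd x (fun l => f l θ) l + f l θ * pd x (fun l => E l θ) l) * Complex.exp (E l θ) := by
  have h1 := (slice_differentiableAt (posT_contDiffOn hf) θ hl).hasFDerivAt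
  have h2 := (slice_differentiableAt (posT_contDiffOn hE) θ hl).hasFDerivAt
  unfold pd
  rw [(h1.fun_mul h2.cexp).fderiv]
  simp
  ring

/-- The structural form of the mixed partial derivatives. -/
lemma foldr_pd_form {M : Matrix R R ℝ} (hM : ∀ x y, 0 ≤ M x y) (L : List R) (hL : L.Nodup) :
    ∃ f ∈ posT {x | x ∈ L}, ∀ l ∈ posO R,
      L.foldr pd (GM M) l = avO (fun θ => f l θ * Complex.exp (expoE M l θ)) ∧
      L.foldr pdR (fun l' => Real.exp (∑ x, ∑ y, M x y * Real.sqrt (l' x * l' y))) l =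
        (f l 0 * Complex.exp (expoE M l 0)).re := by
  induction L with
  | nil =>
    refine ⟨1, one_mem _, fun l hl => ⟨?_, ?_⟩⟩
    · simp only [List.foldr_nil, GM, avO, Pi.one_apply, one_mul, expoE_apply M hl]
      rfl
    · simp only [List.foldr_nil, Pi.one_apply, one_mul, expoE_apply M hl]
      rw [← Complex.ofReal_re (Real.exp _)]
      congr 1
      simp
  | cons x L ih =>
    rw [List.nodup_cons] at hL
    obtain ⟨f, hf, h⟩ := ih hL.2
    have hE := expoE_mem hM {x | x ∈ L}
    obtain ⟨f', hf', h1⟩ := posT_deriv hf (x := x) hL.1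
    obtain ⟨E', hE', h2⟩ := posT_deriv hE (x := x) hL.1
    have hset : insert x {y | y ∈ L} = {y | y ∈ x :: L} := by
      ext y; simp
    have hsm := fexp_contDiffOn hf hE
    refine ⟨f' + f * E', ?_, fun l hl => ⟨?_, ?_⟩⟩
    · rw [← hset]
      exact add_mem hf' (mul_mem (posT_mono (Set.subset_insert _ _) hf) hE')
    · have hev : L.foldr pd (GM M) =ᶠ[nhds l]
          fun l => avO (fun θ => f l θ * Complex.exp (expoE M l θ)) := by
        filter_upwards [posO_isOpen.mem_nhds hl] with l' hl' using (h l' hl').1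
      have e1 : (x :: L).foldr pd (GM M) l =
          pd x (fun l => avO (fun θ => f l θ * Complex.exp (expoE M l θ))) l := by
        rw [List.foldr_cons, pd, Filter.EventuallyEq.fderiv_eq hev]
        rfl
      rw [e1, pd_avO (f := fun l θ => f l θ * Complex.exp (expoE M l θ)) hsm x hl]
      congr 1
      ext θ
      rw [pd_fexp hf hE x hl, h1 l hl, h2 l hl]
      rfl
    · have hev : L.foldr pdR (fun l' => Real.exp (∑ x, ∑ y, M x y * Real.sqrt (l' x * l' y)))
          =ᶠ[nhds l] fun l => (f l 0 * Complex.exp (expoE M l 0)).re := by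
        filter_upwards [posO_isOpen.mem_nhds hl] with l' hl' using (h l' hl').2
      have hd := (slice_differentiableAt
        (f := fun l θ => f l θ * Complex.exp (expoE M l θ)) hsm 0 hl).hasFDerivAt
      have hre := Complex.reCLM.hasFDerivAt.comp l hd
      simp only [List.foldr_cons]
      rw [pdR, Filter.EventuallyEq.fderiv_eq hev]
      have e2 := pd_fexp hf hE x hl 0
      rw [h1 l hl, h2 l hl] at e2
      have e3 : (f' + f * E') l 0 * Complex.exp (expoE M l 0) =
        (f' l 0 + f l 0 * E' l 0) * Complex.exp (expoE M l 0) := rfl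
      rw [e3, ← e2]
      exact congrArg (fun T => T (Pi.single x 1)) hre.fderiv

end Helpers

/-- **Lemma 3.3.** If all entries of `B̃` are nonnegative, then `G_{B̃}` is smooth on
`(0,∞)^R` and all its mixed partial derivatives `∂^Q G_{B̃}` are real and satisfy
`0 ≤ ∂^Q G_{B̃}(l) ≤ ∂^Q H(l)`, where `H(l) = exp(Σ_{x,y} B̃_{x,y} √(l_x l_y))`. -/
theorem GM_mixed_partials_nonneg_le
    {R : Type*} [Fintype R] [DecidableEq R]
    (Bt : Matrix R R ℝ) (hBt : ∀ x y, 0 ≤ Bt x y) :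
    ContDiffOn ℝ (⊤ : ℕ∞) (GM Bt) (Set.univ.pi fun _ : R => Set.Ioi (0:ℝ)) ∧
    ∀ Q : Finset R, ∀ l ∈ Set.univ.pi fun _ : R => Set.Ioi (0:ℝ),
      (mpart Q (GM Bt) l).im = 0 ∧
      0 ≤ (mpart Q (GM Bt) l).re ∧
      (mpart Q (GM Bt) l).re ≤
        mpartR Q (fun l' => Real.exp (∑ x, ∑ y, Bt x y * Real.sqrt (l' x * l' y))) l := by
  constructor
  · have h1 : ContDiffOn ℝ (⊤ : ℕ∞)
        (fun l => avO (fun θ => (1 : (R → ℝ) → (R → ℝ) → ℂ) l θ * Complex.exp (expoE Bt l θ)))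
        (posO R) :=
      avO_contDiffOn
        (f := fun l θ => (1 : (R → ℝ) → (R → ℝ) → ℂ) l θ * Complex.exp (expoE Bt l θ)) (fexp_contDiffOn (one_mem (posT ∅)) (expoE_mem hBt ∅))
    refine h1.congr fun l hl => ?_
    simp only [GM, avO, Pi.one_apply, one_mul, expoE_apply Bt hl]
    rfl
  · intro Q l hl
    obtain ⟨f, hf, h⟩ := foldr_pd_form hBt Q.toList Q.nodup_toList
    obtain ⟨h1, h2⟩ := h l hl
    obtain ⟨h3, h4⟩ := posT_exp_av hf (expoE_mem hBt _) l
    rw [mpart, mpartR, h1, h2]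
    exact ⟨(Complex.le_def.1 h3).2.symm, (Complex.le_def.1 h3).1, (Complex.le_def.1 h4).1⟩

end
end

section
/- Let R be a finite set, a, b ∈ R, and let B be a real R×R matrix with zero diagonal; let η_R = max{ max_{x∈R} Σ_{y∈R∖{x}} |B_{x,y}|, max_{y∈R} Σ_{x∈R∖{y}} |B_{x,y}|, 1 }. Let f : (0,∞)^R → ℝ be infinitely differentiable with (∂^Q f)(l) ≥ 0 for every Q ⊆ R and every l ∈ (0,∞)^R. Then for every l ∈ (0,∞)^R: |(det_{ab}^{(R)}(−B + ∂_l) f)(l)| ≤ η_R · Σ_{Q ⊆ R∖{a,b}} η_R^{|R∖{a,b}|−|Q|} (∂^Q f)(l), i.e. the left-hand side is bounded by η_R ∏_{x∈R∖{a,b}} (η_R + ∂_{l_x}) applied to f at l. -/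
open MeasureTheory Finset

noncomputable section

/-- The `(b,a)` cofactor of the `S × S` submatrix of `M` (real version). -/
def cofDetR {α : Type*} [Fintype α] [DecidableEq α]
    (S : Finset α) (M : Matrix α α ℝ) (a b : α) : ℝ :=
  (Matrix.of fun x y : S => if (x : α) = b then (if (y : α) = a then (1:ℝ) else 0)
    else (if (y : α) = a then 0 else M x y)).det

/-- The differential operator `det_{ab}^{(α)}(M + ∂_l)` applied to `f` at `l`
(real version). -/
def ddetR {α : Type*} [Fintype α] [DecidableEq α]
    (M : Matrix α α ℝ) (a b : α) (f : (α → ℝ) → ℝ) (l : α → ℝ) : ℝ :=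
  ∑ Q ∈ ((Finset.univ : Finset α) \ {a, b}).powerset,
    cofDetR ((Finset.univ : Finset α) \ Q) M a b * mpartR Q f l

theorem abs_det_le_prod_col {n : Type*} [Fintype n] [DecidableEq n] (M : Matrix n n ℝ) :
    |M.det| ≤ ∏ j, ∑ i, |M i j| := by
  rw [Matrix.det_apply', Finset.prod_univ_sum, Fintype.piFinset_univ]
  refine (Finset.abs_sum_le_sum_abs _ _).trans ?_
  have h1 : ∀ σ : Equiv.Perm n, |((Equiv.Perm.sign σ : ℤ) : ℝ) * ∏ i, M (σ i) i|
      = ∏ i, |M (σ i) i| := by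
    intro σ
    rw [abs_mul, Finset.abs_prod]
    rcases Int.units_eq_one_or (Equiv.Perm.sign σ) with h | h <;> simp [h]
  simp only [h1]
  have hinj : Function.Injective (fun σ : Equiv.Perm n => (σ : n → n)) :=
    DFunLike.coe_injective
  rw [← Finset.sum_image (s := Finset.univ) (g := fun σ : Equiv.Perm n => (σ : n → n))
    (f := fun p : n → n => ∏ i, |M (p i) i|) (fun x _ y _ h => hinj h)]
  exact Finset.sum_le_sum_of_subset_of_nonneg (Finset.subset_univ _)
    (fun p _ _ => Finset.prod_nonneg fun i _ => abs_nonneg _)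

theorem abs_cofDetR_le {α : Type*} [Fintype α] [DecidableEq α]
    (S : Finset α) (M : Matrix α α ℝ) (a b : α) (ha : a ∈ S) (η : ℝ) (h1 : 1 ≤ η)
    (hcol : ∀ y, ∑ x, |M x y| ≤ η) :
    |cofDetR S M a b| ≤ η ^ (S.card - 1) := by
  unfold cofDetR
  refine (abs_det_le_prod_col _).trans ?_
  rw [← Finset.mul_prod_erase Finset.univ _ (Finset.mem_univ (⟨a, ha⟩ : S))]
  have hA : ∑ i : S, |(Matrix.of fun x y : S => if (x : α) = b then
      (if (y : α) = a then (1:ℝ) else 0)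
      else (if (y : α) = a then 0 else M x y)) i ⟨a, ha⟩| ≤ 1 := by
    have h0 : ∀ i : S, |(Matrix.of fun x y : S => if (x : α) = b then
        (if (y : α) = a then (1:ℝ) else 0)
        else (if (y : α) = a then 0 else M x y)) i ⟨a, ha⟩| = if (i : α) = b then 1 else 0 := by
      intro i
      simp only [Matrix.of_apply, if_true]
      split_ifs <;> simp
    rw [Finset.sum_congr rfl (fun i _ => h0 i),
      Finset.sum_coe_sort S (fun i : α => if i = b then (1:ℝ) else 0)]
    simp only [Finset.sum_ite_eq']
    split_ifs <;> norm_num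
  have hB : ∏ j ∈ Finset.univ.erase (⟨a, ha⟩ : S), ∑ i : S, |(Matrix.of fun x y : S =>
      if (x : α) = b then (if (y : α) = a then (1:ℝ) else 0)
      else (if (y : α) = a then 0 else M x y)) i j| ≤ η ^ (S.card - 1) := by
    refine (Finset.prod_le_prod (g := fun _ => η)
      (fun j _ => Finset.sum_nonneg fun i _ => abs_nonneg _) ?_).trans ?_
    · intro j hj
      have hja : (j : α) ≠ a := fun h => (Finset.mem_erase.1 hj).1 (Subtype.ext h)
      refine le_trans ?_ (hcol j)
      refine le_trans ?_ (Finset.sum_le_sum_of_subset_of_nonneg (Finset.subset_univ S)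
        (fun p _ _ => abs_nonneg _))
      rw [← Finset.sum_coe_sort S (fun i : α => |M i j|)]
      refine Finset.sum_le_sum fun i _ => ?_
      simp only [Matrix.of_apply, hja, if_false]
      split_ifs <;> simp
    · simp [Finset.card_erase_of_mem]
  calc _ ≤ 1 * η ^ (S.card - 1) := mul_le_mul hA hB
        (Finset.prod_nonneg fun j _ => Finset.sum_nonneg fun i _ => abs_nonneg _) zero_le_one
    _ = _ := one_mul _

/-- **Lemma 3.4.** Let `B` be a real matrix with zero diagonal and
`η_R = max{max_x Σ_{y≠x}|B_{x,y}|, max_y Σ_{x≠y}|B_{x,y}|, 1}`. If `f` is smooth on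
`(0,∞)^R` with all mixed partial derivatives nonnegative there, then
`|(det_{ab}^{(R)}(−B + ∂_l) f)(l)| ≤ η_R Σ_{Q ⊆ R∖{a,b}} η_R^{|R∖{a,b}|−|Q|} (∂^Q f)(l)`,
i.e. it is bounded by `η_R ∏_{x ∈ R∖{a,b}} (η_R + ∂_{l_x})` applied to `f` at `l`. -/
theorem ddet_bound_by_eta
    {R : Type*} [Fintype R] [DecidableEq R]
    (B : Matrix R R ℝ) (hBdiag : ∀ x, B x x = 0)
    (a b : R) (η : ℝ)
    (hη : η = max (max
      (Finset.univ.sup' ⟨a, Finset.mem_univ a⟩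
        (fun x => ∑ y ∈ Finset.univ \ {x}, |B x y|))
      (Finset.univ.sup' ⟨a, Finset.mem_univ a⟩
        (fun y => ∑ x ∈ Finset.univ \ {y}, |B x y|))) 1)
    (f : (R → ℝ) → ℝ)
    (hf : ContDiffOn ℝ (⊤ : ℕ∞) f (Set.univ.pi fun _ : R => Set.Ioi (0:ℝ)))
    (hf_nonneg : ∀ Q : Finset R, ∀ l ∈ Set.univ.pi fun _ : R => Set.Ioi (0:ℝ),
      0 ≤ mpartR Q f l) :
    ∀ l ∈ Set.univ.pi fun _ : R => Set.Ioi (0:ℝ),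
      |ddetR (-B) a b f l| ≤
        η * ∑ Q ∈ ((Finset.univ : Finset R) \ {a, b}).powerset,
          η ^ (((Finset.univ : Finset R) \ {a, b}).card - Q.card) * mpartR Q f l := by
  intro l hl
  have h1 : 1 ≤ η := by rw [hη]; exact le_max_right _ _
  have hcol : ∀ y, ∑ x, |(-B) x y| ≤ η := by
    intro y
    have e : ∑ x, |(-B) x y| = ∑ x ∈ Finset.univ \ {y}, |B x y| := by
      rw [← Finset.sum_sdiff (Finset.subset_univ {y})]
      simp [hBdiag]
    rw [e, hη]
    refine le_trans ?_ (le_max_left _ _)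
    refine le_trans ?_ (le_max_right _ _)
    exact Finset.le_sup' (fun y => ∑ x ∈ Finset.univ \ {y}, |B x y|) (Finset.mem_univ y)
  unfold ddetR
  refine (Finset.abs_sum_le_sum_abs _ _).trans ?_
  rw [Finset.mul_sum]
  refine Finset.sum_le_sum fun Q hQ => ?_
  rw [Finset.mem_powerset] at hQ
  have hm := hf_nonneg Q l hl
  rw [abs_mul, abs_of_nonneg hm, ← mul_assoc, ← pow_succ']
  refine mul_le_mul_of_nonneg_right ?_ hm
  have ha : a ∈ Finset.univ \ Q := by
    simp only [Finset.mem_sdiff, Finset.mem_univ, true_and]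
    intro h
    have := hQ h
    simp at this
  refine (abs_cofDetR_le _ _ a b ha η h1 hcol).trans (pow_le_pow_right₀ h1 ?_)
  have c1 := Finset.card_sdiff_add_card_eq_card (Finset.subset_univ Q)
  have c2 := Finset.card_sdiff_add_card_eq_card (Finset.subset_univ ({a, b} : Finset R))
  have c3 : ({a, b} : Finset R).card ≤ 2 := Finset.card_le_two
  omega

end
end

section
/- Let R be a finite set, a, b ∈ R, let B be a real R×R matrix with zero diagonal, and set η_R = max{ max_{x∈R} Σ_{y∈R∖{x}} |B_{x,y}|, max_{y∈R} Σ_{x∈R∖{y}} |B_{x,y}|, 1 }. Let B̃ be a real R×R matrix with all entries nonnegative, let T > 0, and let l ∈ (0,∞)^R with Σ_{x∈R} l_x = T. Then (det_{ab}^{(R)}(−B + ∂_l) G_{B̃})(l) is a real number and satisfies (det_{ab}^{(R)}(−B + ∂_l) G_{B̃})(l) ≤ exp(Σ_{x,y∈R} B̃_{x,y} √(l_x l_y)) · (∏_{x∈R∖{a,b}} √(T/l_x)) · η_R^{|R|−1} · exp( (η_R^{-1} + (4 η_R^2 T)^{-1}) · Σ_{x,y∈R} B̃_{x,y} ). -/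
open MeasureTheory Finset

noncomputable section

/-- The `(b,a)` cofactor of the `S × S` submatrix of `M`. -/
def cofDet {α : Type*} [Fintype α] [DecidableEq α]
    (S : Finset α) (M : Matrix α α ℂ) (a b : α) : ℂ :=
  (Matrix.of fun x y : S => if (x : α) = b then (if (y : α) = a then (1:ℂ) else 0)
    else (if (y : α) = a then 0 else M x y)).det

/-- The differential operator `det_{ab}^{(α)}(M + ∂_l)` applied to `f` at `l`. -/
def ddet {α : Type*} [Fintype α] [DecidableEq α]
    (M : Matrix α α ℂ) (a b : α) (f : (α → ℝ) → ℂ) (l : α → ℝ) : ℂ :=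
  ∑ Q ∈ ((Finset.univ : Finset α) \ {a, b}).powerset,
    cofDet ((Finset.univ : Finset α) \ Q) M a b * mpart Q f l

/-- The local-time density `ρ_{ab}(l) = (det_{ab}(−A + ∂_l) G_A)(l)`. -/
def rho {α : Type*} [Fintype α] [DecidableEq α]
    (A : Matrix α α ℝ) (a b : α) (l : α → ℝ) : ℂ :=
  ddet ((-A).map (fun r => (r : ℂ))) a b (GM A) l

lemma aux_one_int (n : ℤ) :
    ∫ t in Set.Icc (0:ℝ) (2 * Real.pi), Complex.exp (Complex.I * ((n:ℂ) * (t:ℂ)))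
      = if n = 0 then (2 * Real.pi : ℂ) else 0 := by
  have hpi : (0:ℝ) ≤ 2 * Real.pi := by positivity
  rw [integral_Icc_eq_integral_Ioc, ← intervalIntegral.integral_of_le hpi]
  split_ifs with h
  · subst h; simp
  · have hc : Complex.I * (n:ℂ) ≠ 0 := by simp [h]
    have := integral_exp_mul_complex (a := 0) (b := 2 * Real.pi) hc
    simp only [mul_assoc] at this
    rw [this]
    have h2 : Complex.exp (Complex.I * ((n:ℂ) * ((2 * Real.pi : ℝ) : ℂ))) = 1 := by
      rw [Complex.exp_eq_one_iff]
      exact ⟨n, by push_cast; ring⟩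
    rw [h2]; simp

lemma aux_box_int {R : Type*} [Fintype R] [DecidableEq R] (p q : R → ℕ) :
    ∫ θ in Set.univ.pi (fun _ : R => Set.Icc (0:ℝ) (2 * Real.pi)),
      ∏ x, (Complex.exp (Complex.I * (θ x : ℂ)) ^ p x *
        Complex.exp (-(Complex.I * (θ x : ℂ))) ^ q x)
      = if p = q then (2 * Real.pi : ℂ) ^ (Fintype.card R) else 0 := by
  have h1 : ∀ x (t : ℝ), Complex.exp (Complex.I * (t : ℂ)) ^ p x *
        Complex.exp (-(Complex.I * (t : ℂ))) ^ q x =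
        Complex.exp (Complex.I * ((((p x : ℤ) - (q x : ℤ) : ℤ) : ℂ) * (t:ℂ))) := by
    intro x t
    rw [← Complex.exp_nat_mul, ← Complex.exp_nat_mul, ← Complex.exp_add]
    congr 1; push_cast; ring
  simp only [h1]
  rw [volume_pi, Measure.restrict_pi_pi]
  rw [integral_fintype_prod_eq_prod (𝕜 := ℂ) (fun x (t:ℝ) =>
    Complex.exp (Complex.I * ((((p x : ℤ) - (q x : ℤ) : ℤ) : ℂ) * (t:ℂ))))]
  simp only [aux_one_int]
  split_ifs with h
  · subst h; simp
  · obtain ⟨x, hx⟩ := Function.ne_iff.mp h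
    apply Finset.prod_eq_zero (Finset.mem_univ x)
    rw [if_neg]; omega

lemma aux_fiber {ι R M : Type*} [Fintype ι] [Fintype R] [DecidableEq R] [CommMonoid M]
    (g : ι → R) (f : R → M) :
    ∏ i, f (g i) = ∏ x, f x ^ (#{i | g i = x}) := by
  rw [← Finset.prod_fiberwise' Finset.univ g f]
  simp

/-- Hadamard-type row-sum bound. -/
lemma aux_det_bound {n : Type*} [Fintype n] [DecidableEq n] (A : Matrix n n ℂ) :
    ‖A.det‖ ≤ ∏ i, ∑ j, ‖A i j‖ := by
  rw [← Matrix.det_transpose, Matrix.det_apply, Finset.prod_univ_sum]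
  refine (norm_sum_le _ _).trans ?_
  have : ∀ σ : Equiv.Perm n, ‖Equiv.Perm.sign σ • ∏ i, A.transpose (σ i) i‖ = ∏ i, ‖A i (σ i)‖ := by
    intro σ
    rcases Int.units_eq_one_or (Equiv.Perm.sign σ) with h | h <;> simp [h]
  simp only [this, Fintype.piFinset_univ]
  refine (Finset.sum_map Finset.univ
    ⟨fun σ : Equiv.Perm n => (σ : n → n), DFunLike.coe_injective⟩
    (fun f : n → n => ∏ i, ‖A i (f i)‖)).symm.le.trans ?_
  apply Finset.sum_le_sum_of_subset_of_nonneg (Finset.subset_univ _)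
  intros; positivity

lemma aux_cof_bound {R : Type*} [Fintype R] [DecidableEq R]
    (B : Matrix R R ℝ) (a b : R) (η : ℝ) (hB : ∀ x, ∑ y, |B x y| ≤ η)
    (S : Finset R) (hb : b ∈ S) :
    ‖cofDet S ((-B).map (fun c => (c : ℂ))) a b‖ ≤ η ^ (#S - 1) := by
  unfold cofDet
  refine (aux_det_bound _).trans ?_
  have : ∀ x : S, ∑ y : S, ‖(Matrix.of fun x y : S => if (x : R) = b then (if (y : R) = a then (1:ℂ) else 0)
    else (if (y : R) = a then 0 else ((-B).map (fun c => (c : ℂ))) x y)) x y‖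
      ≤ if x = ⟨b, hb⟩ then 1 else η := by
    intro x
    by_cases hx : x = ⟨b, hb⟩
    · subst hx
      simp only [Matrix.of_apply, if_true]
      rw [Finset.sum_coe_sort S (fun y => ‖if y = a then (1:ℂ) else 0‖)]
      simp only [apply_ite norm, norm_one, norm_zero, Finset.sum_ite_eq']
      split_ifs <;> norm_num
    · have hx' : (x : R) ≠ b := fun h => hx (Subtype.ext h)
      simp only [Matrix.of_apply, if_neg hx, if_neg hx']
      refine le_trans ?_ (hB x)
      rw [Finset.sum_coe_sort S (fun y => ‖if y = a then (0:ℂ) else ((-B).map (fun c => (c : ℂ))) x y‖)]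
      refine le_trans (Finset.sum_le_sum (g := fun y => |B x y|) ?_)
        (Finset.sum_le_sum_of_subset_of_nonneg (Finset.subset_univ _) (by intros; positivity))
      intro y _
      split_ifs <;> simp
  refine (Finset.prod_le_prod (by intros; positivity) (fun x _ => this x)).trans ?_
  rw [Finset.prod_ite, Finset.prod_const_one, one_mul, Finset.prod_const, Finset.filter_ne',
    Finset.card_erase_of_mem (Finset.mem_univ _)]
  simp

lemma aux_cof_real {R : Type*} [Fintype R] [DecidableEq R]
    (B : Matrix R R ℝ) (a b : R) (S : Finset R) :
    ∃ r : ℝ, cofDet S ((-B).map (fun c => (c : ℂ))) a b = r := by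
  refine ⟨(Matrix.of fun x y : S => if (x : R) = b then (if (y : R) = a then (1:ℝ) else 0)
    else (if (y : R) = a then 0 else (-B) x y)).det, ?_⟩
  unfold cofDet
  rw [← Complex.ofRealHom_eq_coe, RingHom.map_det]
  congr 1
  ext x y
  simp [apply_ite Complex.ofReal]

lemma aux_pow_deriv (k : ℕ) (t M : ℝ) (ht : 0 ≤ t) (htM : t ≤ M) :
    (k : ℝ) * t ^ (k - 1) ≤ (M + 1) ^ k := by
  cases k with
  | zero => simp
  | succ k =>
    have h0 : 0 ≤ M := ht.trans htM
    have h1 : ((k + 1 : ℕ) : ℝ) * t ^ k ≤ ((k + 1 : ℕ) : ℝ) * M ^ k := by gcongr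
    have h2 := add_pow M 1 (k + 1)
    have h3 : M ^ k * 1 ^ (k + 1 - k) * ((k + 1).choose k : ℝ) ≤ (M + 1) ^ (k + 1) := by
      rw [h2]
      exact Finset.single_le_sum
        (f := fun m => M ^ m * 1 ^ (k + 1 - m) * ((k + 1).choose m : ℝ))
        (by intros; positivity) (by simp)
    simp only [Nat.choose_succ_self_right, one_pow, mul_one] at h3
    simp only [Nat.add_sub_cancel]
    linarith

lemma aux_hasSum_apply {E J : Type*} [NormedAddCommGroup E] [NormedSpace ℝ E]
    {φ : J → (E →L[ℝ] ℝ)} (h : Summable φ) (v : E) :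
    HasSum (fun j => φ j v) ((∑' j, φ j) v) :=
  h.hasSum.mapL (ContinuousLinearMap.apply ℝ ℝ v)

/-- Termwise differentiation of a power series with nonnegative coefficients. -/
lemma aux_series_fderiv {R J : Type*} [Fintype R] [DecidableEq R]
    (c : J → ℝ) (hc : ∀ j, 0 ≤ c j) (k : J → R → ℕ)
    (hs : ∀ l : R → ℝ, (∀ x, 0 < l x) → Summable fun j => c j * ∏ x, l x ^ k j x)
    (l : R → ℝ) (hl : ∀ x, 0 < l x) (x : R) :
    (Summable fun j => c j * ((k j x : ℝ) * l x ^ (k j x - 1) * ∏ y ∈ univ.erase x, l y ^ k j y)) ∧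
    fderiv ℝ (fun l : R → ℝ => ((∑' j, c j * ∏ x, l x ^ k j x : ℝ) : ℂ)) l (Pi.single x 1) =
      ((∑' j, c j * ((k j x : ℝ) * l x ^ (k j x - 1) * ∏ y ∈ univ.erase x, l y ^ k j y) : ℝ) : ℂ) := by
  obtain ⟨M, hM⟩ : ∃ M : ℝ, ∀ x, l x < M := by
    refine ⟨∑ x, l x + 1, fun x => ?_⟩
    have := Finset.single_le_sum (f := l) (fun i _ => (hl i).le) (Finset.mem_univ x)
    linarith
  have hM0 : 0 < M := (hl x).trans (hM x)
  set s : Set (R → ℝ) := Set.univ.pi (fun _ => Set.Ioo 0 M) with hsdef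
  have hls : l ∈ s := fun x _ => ⟨hl x, hM x⟩
  have hso : IsOpen s := isOpen_set_pi Set.finite_univ (fun _ _ => isOpen_Ioo)
  have hsc : IsPreconnected s := (convex_pi (fun _ _ => convex_Ioo 0 M)).isPreconnected
  let f' : J → (R → ℝ) → ((R → ℝ) →L[ℝ] ℝ) := fun j l =>
    c j • ∑ y, (∏ z ∈ univ.erase y, l z ^ k j z) •
      (((k j y : ℝ) * l y ^ (k j y - 1)) • ContinuousLinearMap.proj (R := ℝ) (φ := fun _ : R => ℝ) y)
  have hu := (hs (fun _ => M + 1) (fun _ => by linarith)).mul_left (Fintype.card R : ℝ)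
  have hf : ∀ j, ∀ l ∈ s, HasFDerivAt (fun l : R → ℝ => c j * ∏ x, l x ^ k j x) (f' j l) l := by
    intro j l _
    refine HasFDerivAt.const_mul ?_ (c j)
    apply HasFDerivAt.finsetProd
    intro y _
    have h1 : HasFDerivAt (fun l : R → ℝ => l y)
        (ContinuousLinearMap.proj (R := ℝ) (φ := fun _ : R => ℝ) y) l :=
      (ContinuousLinearMap.proj (R := ℝ) (φ := fun _ : R => ℝ) y).hasFDerivAt
    have h2 := h1.pow (k j y)
    simpa [nsmul_eq_mul] using h2
  have hterm : ∀ j, ∀ l ∈ s, ∀ y, (∏ z ∈ univ.erase y, l z ^ k j z) * ((k j y : ℝ) * l y ^ (k j y - 1))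
      ≤ ∏ z, (M + 1) ^ k j z := by
    intro j l hl y
    rw [← Finset.prod_erase_mul _ _ (Finset.mem_univ y)]
    have hp : ∀ z, 0 ≤ l z := fun z => (hl z trivial).1.le
    have hq : ∀ z, l z ≤ M := fun z => (hl z trivial).2.le
    have := hp y
    apply mul_le_mul
    · apply Finset.prod_le_prod
      · intro z _; exact pow_nonneg (hp z) _
      · intro z _; exact pow_le_pow_left₀ (hp z) (by linarith [hq z]) _
    · exact aux_pow_deriv _ _ _ (hp y) (hq y)
    · positivity
    · positivity
  have hf' : ∀ j, ∀ l ∈ s, ‖f' j l‖ ≤ (Fintype.card R : ℝ) * (c j * ∏ z, (M + 1) ^ k j z) := by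
    intro j l hl
    have hp : ∀ z, 0 ≤ l z := fun z => (hl z trivial).1.le
    have h0 : ‖∑ y, (∏ z ∈ univ.erase y, l z ^ k j z) •
      (((k j y : ℝ) * l y ^ (k j y - 1)) • ContinuousLinearMap.proj (R := ℝ) (φ := fun _ : R => ℝ) y)‖
        ≤ (Fintype.card R : ℝ) * ∏ z, (M + 1) ^ k j z := by
      refine (norm_sum_le _ _).trans ?_
      rw [← nsmul_eq_mul]
      refine Finset.sum_le_card_nsmul _ _ _ ?_
      intro y _
      have e1 : 0 ≤ (∏ z ∈ univ.erase y, l z ^ k j z) :=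
        Finset.prod_nonneg fun z _ => pow_nonneg (hp z) _
      have e2 : 0 ≤ ((k j y : ℝ) * l y ^ (k j y - 1)) := mul_nonneg (by positivity) (pow_nonneg (hp y) _)
      have e3 : ‖ContinuousLinearMap.proj (R := ℝ) (φ := fun _ : R => ℝ) y‖ ≤ 1 := by
        apply ContinuousLinearMap.opNorm_le_bound _ zero_le_one
        intro v
        simpa using norm_le_pi_norm v y
      rw [norm_smul, norm_smul, Real.norm_of_nonneg e1, Real.norm_of_nonneg e2, ← mul_assoc]
      exact (mul_le_of_le_one_right (mul_nonneg e1 e2) e3).trans (hterm j l hl y)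
    show ‖c j • _‖ ≤ _
    rw [norm_smul, Real.norm_of_nonneg (hc j), mul_left_comm]
    exact mul_le_mul_of_nonneg_left h0 (hc j)
  have key := hasFDerivAt_tsum_of_isPreconnected hu hso hsc hf hf' hls (hs l hl) hls
  have hsf : Summable fun j => f' j l := hu.of_norm_bounded (fun j => hf' j l hls)
  have hval : ∀ j, f' j l (Pi.single x 1) =
      c j * ((k j x : ℝ) * l x ^ (k j x - 1) * ∏ y ∈ univ.erase x, l y ^ k j y) := by
    intro j
    simp only [f', smul_apply, _root_.sum_apply,
      ContinuousLinearMap.proj_apply, smul_eq_mul]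
    rw [Finset.sum_eq_single x]
    · simp; left; ring
    · intro y _ hy; simp [hy]
    · simp
  have hsum : HasSum (fun j => f' j l (Pi.single x 1)) ((∑' j, f' j l) (Pi.single x 1)) := by
    exact aux_hasSum_apply hsf _
  simp only [hval] at hsum
  refine ⟨hsum.summable, ?_⟩
  have key2 := Complex.ofRealCLM.hasFDerivAt.comp l key
  have := key2.fderiv
  erw [this]
  rw [hsum.tsum_eq]
  rfl

/-- Mixed partial derivatives of the series on the positive orthant. -/
lemma aux_series_mpart {R J : Type*} [Fintype R] [DecidableEq R]
    (c : J → ℝ) (hc : ∀ j, 0 ≤ c j) (k : J → R → ℕ)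
    (hs : ∀ l : R → ℝ, (∀ x, 0 < l x) → Summable fun j => c j * ∏ x, l x ^ k j x)
    (f : (R → ℝ) → ℂ)
    (hf : ∀ l : R → ℝ, (∀ x, 0 < l x) → f l = ((∑' j, c j * ∏ x, l x ^ k j x : ℝ) : ℂ))
    (L : List R) (hL : L.Nodup) :
    (∀ l : R → ℝ, (∀ x, 0 < l x) → 
      Summable (fun j => (c j * ∏ x ∈ L.toFinset, (k j x : ℝ)) *
        ∏ x, l x ^ (if x ∈ L then k j x - 1 else k j x))) ∧
    (∀ l : R → ℝ, (∀ x, 0 < l x) → 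
      L.foldr pd f l = ((∑' j, (c j * ∏ x ∈ L.toFinset, (k j x : ℝ)) *
        ∏ x, l x ^ (if x ∈ L then k j x - 1 else k j x) : ℝ) : ℂ)) := by
  induction L with
  | nil => simpa using ⟨hs, hf⟩
  | cons x L ih =>
    obtain ⟨hx, hL⟩ := List.nodup_cons.mp hL
    obtain ⟨ih1, ih2⟩ := ih hL
    have hterm : ∀ (l : R → ℝ) j, (c j * ∏ y ∈ (x :: L).toFinset, (k j y : ℝ)) *
        ∏ y, l y ^ (if y ∈ x :: L then k j y - 1 else k j y) = 
        (c j * ∏ x ∈ L.toFinset, (k j x : ℝ)) *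
          (((if x ∈ L then k j x - 1 else k j x : ℕ) : ℝ) * l x ^ ((if x ∈ L then k j x - 1 else k j x) - 1) *
            ∏ y ∈ univ.erase x, l y ^ (if y ∈ L then k j y - 1 else k j y)) := by
      intro l j
      rw [List.toFinset_cons, Finset.prod_insert (by simpa using hx), if_neg hx,
        ← Finset.mul_prod_erase _ _ (Finset.mem_univ x), if_pos (by simp)]
      have : ∏ y ∈ univ.erase x, l y ^ (if y ∈ x :: L then k j y - 1 else k j y) =
          ∏ y ∈ univ.erase x, l y ^ (if y ∈ L then k j y - 1 else k j y) := by
        apply Finset.prod_congr rfl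
        intro y hy
        have : y ≠ x := (Finset.mem_erase.mp hy).1
        simp [this]
      rw [this]; ring
    have hD := fun l hl => aux_series_fderiv (fun j => c j * ∏ x ∈ L.toFinset, (k j x : ℝ))
      (fun j => mul_nonneg (hc j) (by positivity)) (fun j x => if x ∈ L then k j x - 1 else k j x) ih1 l hl x
    simp only [hterm]
    refine ⟨fun l hl => (hD l hl).1, fun l hl => ?_⟩
    rw [← (hD l hl).2, List.foldr_cons, pd]
    congr 1
    apply Filter.EventuallyEq.fderiv_eq
    have : {l : R → ℝ | ∀ x, 0 < l x} ∈ nhds l := by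
      have h1 : IsOpen (Set.univ.pi (fun _ : R => Set.Ioi (0:ℝ))) :=
        isOpen_set_pi Set.finite_univ (fun _ _ => isOpen_Ioi)
      have h2 := h1.mem_nhds (x := l) (fun x _ => hl x)
      filter_upwards [h2] with m hm x using hm x trivial
    filter_upwards [this] with m hm using ih2 m hm

lemma aux_sum_fun {P 𝕜 : Type*} [Fintype P] [DecidableEq P] [Field 𝕜] (w : P → 𝕜) (m : ℕ) :
    ∑ f : Fin m → P, ((m.factorial : 𝕜))⁻¹ * ∏ i, w (f i) = (∑ p, w p) ^ m / (m.factorial : 𝕜) := by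
  rw [← Finset.mul_sum, div_eq_inv_mul]
  congr 1
  have := Finset.prod_univ_sum (fun _ : Fin m => (univ : Finset P)) (fun _ p => w p)
  simp only [Fintype.piFinset_univ, Finset.prod_const, Finset.card_univ, Fintype.card_fin] at this
  exact this.symm

lemma aux_exp_summable {P : Type*} [Fintype P] [DecidableEq P] (w : P → ℝ) (hw : ∀ p, 0 ≤ w p) :
    Summable (fun j : (Σ m : ℕ, (Fin m → P)) => ((j.1.factorial : ℝ))⁻¹ * ∏ i, w (j.2 i)) := by
  rw [summable_sigma_of_nonneg]
  · refine ⟨fun m => Summable.of_finite, ?_⟩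
    simp only [tsum_fintype, aux_sum_fun]
    exact Real.summable_pow_div_factorial _
  · intro j
    exact mul_nonneg (by positivity) (Finset.prod_nonneg fun i _ => hw _)

lemma aux_exp_tsum {P : Type*} [Fintype P] [DecidableEq P] (w : P → ℂ) :
    ∑' j : (Σ m : ℕ, (Fin m → P)), ((j.1.factorial : ℂ))⁻¹ * ∏ i, w (j.2 i) =
      Complex.exp (∑ p, w p) := by
  have hs : Summable (fun j : (Σ m : ℕ, (Fin m → P)) => ((j.1.factorial : ℂ))⁻¹ * ∏ i, w (j.2 i)) := by
    apply Summable.of_norm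
    have := aux_exp_summable (fun p => ‖w p‖) (fun p => norm_nonneg _)
    simpa using this
  rw [hs.tsum_sigma]
  simp only [tsum_fintype, aux_sum_fun]
  rw [Complex.exp_eq_exp_ℂ, NormedSpace.exp_eq_tsum_div]

lemma aux_GM_series {R : Type*} [Fintype R] [DecidableEq R]
    (Bt : Matrix R R ℝ) (hBt : ∀ x y, 0 ≤ Bt x y) :
    ∃ (c : (Σ m : ℕ, (Fin m → R × R)) → ℝ) (k : (Σ m : ℕ, (Fin m → R × R)) → R → ℕ),
      (∀ j, 0 ≤ c j) ∧ ∀ l : R → ℝ, (∀ x, 0 < l x) →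
        HasSum (fun j => ((c j * ∏ x, l x ^ k j x : ℝ) : ℂ)) (GM Bt l) := by
  let ou : (Σ m : ℕ, (Fin m → R × R)) → R → ℕ := fun j x => #{i | (j.2 i).1 = x}
  let inn : (Σ m : ℕ, (Fin m → R × R)) → R → ℕ := fun j x => #{i | (j.2 i).2 = x}
  refine ⟨fun j => if ou j = inn j then ((j.1.factorial : ℝ))⁻¹ * ∏ i, Bt (j.2 i).1 (j.2 i).2 else 0,
    ou, ?_, ?_⟩
  · intro j
    dsimp only
    split_ifs
    · exact mul_nonneg (by positivity) (Finset.prod_nonneg fun i _ => hBt _ _)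
    · exact le_rfl
  intro l hl
  let u : R × R → ℝ := fun p => Bt p.1 p.2 * Real.sqrt (l p.1 * l p.2)
  have hu : ∀ p, 0 ≤ u p := fun p => mul_nonneg (hBt _ _) (Real.sqrt_nonneg _)
  let w : (R → ℝ) → R × R → ℂ := fun θ p => (Bt p.1 p.2 : ℂ) * (Real.sqrt (l p.1 * l p.2) : ℂ) *
        Complex.exp (Complex.I * ((θ p.1 : ℂ) - (θ p.2 : ℂ)))
  have hnw : ∀ θ p, ‖w θ p‖ = u p := by
    intro θ p
    have : Complex.I * ((θ p.1 : ℂ) - (θ p.2 : ℂ)) = ((θ p.1 - θ p.2 : ℝ) : ℂ) * Complex.I := by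
      push_cast; ring
    simp only [w, u]
    rw [norm_mul, norm_mul, this, Complex.norm_exp_ofReal_mul_I, mul_one, Complex.norm_real,
      Complex.norm_real, Real.norm_of_nonneg (hBt _ _), Real.norm_of_nonneg (Real.sqrt_nonneg _)]
  let F : (Σ m : ℕ, (Fin m → R × R)) → (R → ℝ) → ℂ := fun j θ =>
    ((j.1.factorial : ℂ))⁻¹ * ∏ i, w θ (j.2 i)
  have hnF : ∀ j θ, ‖F j θ‖ = ((j.1.factorial : ℝ))⁻¹ * ∏ i, u (j.2 i) := by
    intro j θ
    simp [F, hnw]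
  let box := Set.univ.pi (fun _ : R => Set.Icc (0:ℝ) (2 * Real.pi))
  have hbc : IsCompact box := isCompact_univ_pi fun _ => isCompact_Icc
  have hFc : ∀ j, Continuous (F j) := by
    intro j
    simp only [F, w]
    fun_prop
  have hint := hasSum_integral_of_summable_integral_norm (μ := volume.restrict box) (F := F)
    (fun j => (hFc j).continuousOn.integrableOn_compact hbc)
    (by
      simp only [hnF, integral_const]
      exact (aux_exp_summable u hu).const_smul _)
  have hexp : ∀ θ, ∑' j, F j θ = Complex.exp (∑ x, ∑ y, (Bt x y : ℂ) * (Real.sqrt (l x * l y) : ℂ) *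
        Complex.exp (Complex.I * ((θ x : ℂ) - (θ y : ℂ)))) := by
    intro θ
    rw [aux_exp_tsum (w θ), Fintype.sum_prod_type]
  simp only [hexp] at hint
  have hint2 := hint.mul_left (((2 * Real.pi : ℂ) ^ (Fintype.card R))⁻¹)
  unfold GM
  suffices hfun : ∀ j, (((if ou j = inn j then ((j.1.factorial : ℝ))⁻¹ *
      ∏ i, Bt (j.2 i).1 (j.2 i).2 else 0) * ∏ x, l x ^ ou j x : ℝ) : ℂ) =
      ((2 * Real.pi : ℂ) ^ (Fintype.card R))⁻¹ * ∫ θ in box, F j θ by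
    simp only [hfun]
    exact hint2
  intro j
  have hFj : ∀ θ, F j θ = (((j.1.factorial : ℂ))⁻¹ * ∏ i, (u (j.2 i) : ℂ)) *
      ∏ x, (Complex.exp (Complex.I * (θ x : ℂ)) ^ ou j x *
        Complex.exp (-(Complex.I * (θ x : ℂ))) ^ inn j x) := by
    intro θ
    rw [Finset.prod_mul_distrib]
    simp only [ou, inn]
    rw [← aux_fiber (fun i => (j.2 i).1) (fun x => Complex.exp (Complex.I * (θ x : ℂ))),
      ← aux_fiber (fun i => (j.2 i).2) (fun x => Complex.exp (-(Complex.I * (θ x : ℂ)))),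
      mul_assoc, ← Finset.prod_mul_distrib, ← Finset.prod_mul_distrib]
    simp only [F, w, u]
    congr 1
    apply Finset.prod_congr rfl
    intro i _
    rw [← Complex.exp_add]
    push_cast
    congr 2
    ring
  simp only [hFj]
  rw [integral_const_mul]
  have hbx := aux_box_int (ou j) (inn j)
  erw [hbx]
  by_cases h : ou j = inn j
  · rw [if_pos h, if_pos h]
    have hpi : ((2 * Real.pi : ℂ) ^ (Fintype.card R)) ≠ 0 := by
      apply pow_ne_zero
      simp [Real.pi_ne_zero]
    have hcan : ∀ z w : ℂ, w ≠ 0 → w⁻¹ * (z * w) = z := fun z w hw => by field_simp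
    rw [hcan _ _ hpi]
    have hprod : ∏ i, u (j.2 i) = (∏ i, Bt (j.2 i).1 (j.2 i).2) * ∏ x, l x ^ ou j x := by
      simp only [u]
      rw [Finset.prod_mul_distrib]
      congr 1
      have : ∀ i, Real.sqrt (l (j.2 i).1 * l (j.2 i).2) =
          Real.sqrt (l (j.2 i).1) * Real.sqrt (l (j.2 i).2) := fun i => Real.sqrt_mul (hl _).le _
      simp only [this]
      rw [Finset.prod_mul_distrib, aux_fiber (fun i => (j.2 i).1) (fun x => Real.sqrt (l x)),
        aux_fiber (fun i => (j.2 i).2) (fun x => Real.sqrt (l x)), ← Finset.prod_mul_distrib]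
      apply Finset.prod_congr rfl
      intro x _
      have hx : #{i | (j.2 i).2 = x} = ou j x := (congrFun h x).symm
      rw [hx]
      show Real.sqrt (l x) ^ ou j x * _ = _
      rw [← mul_pow, Real.mul_self_sqrt (hl x).le]
    rw [← Complex.ofReal_prod, hprod]
    push_cast
    ring
  · rw [if_neg h, if_neg h]; simp

lemma aux_GM_norm {R : Type*} [Fintype R] [DecidableEq R]
    (Bt : Matrix R R ℝ) (hBt : ∀ x y, 0 ≤ Bt x y) (l : R → ℝ) :
    ‖GM Bt l‖ ≤ Real.exp (∑ x, ∑ y, Bt x y * Real.sqrt (l x * l y)) := by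
  unfold GM
  have hvol : volume.real (Set.univ.pi (fun _ : R => Set.Icc (0:ℝ) (2 * Real.pi))) =
      (2 * Real.pi) ^ (Fintype.card R) := by
    have hp : (0:ℝ) ≤ 2 * Real.pi := by positivity
    rw [Measure.real, volume_pi_pi, ENNReal.toReal_prod]
    simp [Real.pi_pos.le]
  have hfin : volume (Set.univ.pi (fun _ : R => Set.Icc (0:ℝ) (2 * Real.pi))) < ⊤ :=
    (isCompact_univ_pi fun _ => isCompact_Icc).measure_lt_top
  have := norm_setIntegral_le_of_norm_le_const (μ := volume) hfin
    (C := Real.exp (∑ x, ∑ y, Bt x y * Real.sqrt (l x * l y)))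
    (f := fun θ : R → ℝ => Complex.exp (∑ x, ∑ y, (Bt x y : ℂ) * (Real.sqrt (l x * l y) : ℂ) *
        Complex.exp (Complex.I * ((θ x : ℂ) - (θ y : ℂ)))))
    (by
      intro θ _
      rw [Complex.norm_exp]
      apply Real.exp_le_exp.mpr
      refine (Complex.re_le_norm _).trans ?_
      refine (norm_sum_le _ _).trans (Finset.sum_le_sum fun x _ => ?_)
      refine (norm_sum_le _ _).trans (Finset.sum_le_sum fun y _ => ?_)
      have : Complex.I * ((θ x : ℂ) - (θ y : ℂ)) = ((θ x - θ y : ℝ) : ℂ) * Complex.I := by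
        push_cast; ring
      rw [norm_mul, norm_mul, this, Complex.norm_exp_ofReal_mul_I, mul_one, Complex.norm_real,
        Complex.norm_real, Real.norm_of_nonneg (hBt _ _), Real.norm_of_nonneg (Real.sqrt_nonneg _)])
  rw [hvol] at this
  have hpos : (0:ℝ) < (2 * Real.pi) ^ (Fintype.card R) := by positivity
  have hn : ‖((2 * Real.pi : ℂ) ^ (Fintype.card R))⁻¹‖ = ((2 * Real.pi) ^ (Fintype.card R))⁻¹ := by
    simp [abs_of_pos Real.pi_pos]
  rw [norm_mul, hn, inv_mul_le_iff₀ hpos]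
  exact this.trans_eq (mul_comm _ _)

lemma aux_factor (η T l : ℝ) (k : ℕ) (hη : 1 ≤ η) (hT : 0 < T) (hl : 0 < l) (hlT : l ≤ T) :
    (1 + (k / l) / η) * l ^ k ≤
      Real.sqrt (T / l) * (l * (1 + 1 / (η * Real.sqrt l * Real.sqrt T))) ^ k := by
  have h0 : 0 < η := by linarith
  set s := Real.sqrt l with hs
  set t := Real.sqrt T with ht
  have hs0 : 0 < s := Real.sqrt_pos.mpr hl
  have ht0 : 0 < t := Real.sqrt_pos.mpr hT
  have hst : s ≤ t := Real.sqrt_le_sqrt hlT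
  have hls : l = s ^ 2 := (Real.sq_sqrt hl.le).symm
  rw [Real.sqrt_div hT.le, ← hs, ← ht, mul_pow]
  have hd : 0 < 1 / (η * s * t) := by positivity
  have hb := one_add_mul_le_pow (a := 1 / (η * s * t)) (by linarith) k
  have h1 : 1 + (k / l) / η ≤ t / s * (1 + k * (1 / (η * s * t))) := by
    have e : t / s * (1 + k * (1 / (η * s * t))) = t / s + (k / l) / η := by
      rw [hls]; field_simp
    rw [e]
    have : 1 ≤ t / s := by rwa [one_le_div hs0]
    linarith
  have h2 : t / s * (1 + k * (1 / (η * s * t))) ≤ t / s * (1 + 1 / (η * s * t)) ^ k := by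
    apply mul_le_mul_of_nonneg_left hb (by positivity)
  calc (1 + (k / l) / η) * l ^ k ≤ (t / s * (1 + 1 / (η * s * t)) ^ k) * l ^ k :=
        mul_le_mul_of_nonneg_right (h1.trans h2) (by positivity)
    _ = _ := by ring

lemma aux_sqrt (η T l m : ℝ) (hη : 1 ≤ η) (hT : 0 < T) (hl : 0 < l) (hlT : l ≤ T)
    (hm : 0 < m) (hmT : m ≤ T) :
    Real.sqrt ((l * (1 + 1 / (η * Real.sqrt l * Real.sqrt T))) *
      (m * (1 + 1 / (η * Real.sqrt m * Real.sqrt T)))) ≤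
      Real.sqrt (l * m) + (η⁻¹ + (4 * η ^ 2 * T)⁻¹) := by
  have h0 : 0 < η := by linarith
  set t := Real.sqrt T with ht
  have ht0 : 0 < t := Real.sqrt_pos.mpr hT
  have hTt : T = t ^ 2 := (Real.sq_sqrt hT.le).symm
  have key : ∀ l, 0 < l → l * (1 + 1 / (η * Real.sqrt l * t)) ≤ (Real.sqrt l + 1 / (2 * η * t)) ^ 2 := by
    intro l hl
    have hs0 : 0 < Real.sqrt l := Real.sqrt_pos.mpr hl
    have hls : l = Real.sqrt l ^ 2 := (Real.sq_sqrt hl.le).symm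
    have e : l * (1 + 1 / (η * Real.sqrt l * t)) =
        (Real.sqrt l + 1 / (2 * η * t)) ^ 2 - (1 / (2 * η * t)) ^ 2 := by
      nth_rewrite 1 [hls]
      field_simp
      ring
    rw [e]
    have : 0 ≤ (1 / (2 * η * t)) ^ 2 := by positivity
    linarith
  have hs : Real.sqrt l ≤ t := Real.sqrt_le_sqrt hlT
  have hsm : Real.sqrt m ≤ t := Real.sqrt_le_sqrt hmT
  rw [Real.sqrt_mul hl.le]
  have hp1 : 0 ≤ Real.sqrt l + 1 / (2 * η * t) := by positivity
  have hp2 : 0 ≤ Real.sqrt m + 1 / (2 * η * t) := by positivity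
  have h1 : Real.sqrt ((l * (1 + 1 / (η * Real.sqrt l * t))) * (m * (1 + 1 / (η * Real.sqrt m * t)))) ≤
      (Real.sqrt l + 1 / (2 * η * t)) * (Real.sqrt m + 1 / (2 * η * t)) := by
    apply Real.sqrt_le_iff.mpr
    refine ⟨by positivity, ?_⟩
    rw [mul_pow]
    apply mul_le_mul (key l hl) (key m hm) (by positivity) (by positivity)
  refine h1.trans ?_
  have e2 : (Real.sqrt l + 1 / (2 * η * t)) * (Real.sqrt m + 1 / (2 * η * t)) =
      Real.sqrt l * Real.sqrt m + (Real.sqrt l + Real.sqrt m) / (2 * η * t) + (4 * η ^ 2 * T)⁻¹ := by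
    rw [hTt]; field_simp; ring
  have e3 : (Real.sqrt l + Real.sqrt m) / (2 * η * t) ≤ η⁻¹ := by
    rw [div_le_iff₀ (by positivity)]
    have : η⁻¹ * (2 * η * t) = 2 * t := by field_simp
    linarith
  rw [e2]; linarith

/-- **Lemma 3.5.** Let `B` have zero diagonal with
`η_R = max{max_x Σ_{y≠x}|B_{x,y}|, max_y Σ_{x≠y}|B_{x,y}|, 1}`, let `B̃` have
nonnegative entries, `T > 0` and `l ∈ (0,∞)^R` with `Σ l_x = T`. Then
`(det_{ab}^{(R)}(−B + ∂_l) G_{B̃})(l)` is real and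
`≤ e^{Σ B̃_{x,y}√(l_x l_y)} (∏_{x∈R∖{a,b}} √(T/l_x)) η_R^{|R|−1}
  e^{(η_R⁻¹ + (4η_R²T)⁻¹) Σ B̃_{x,y}}`. -/
theorem ddet_GM_upper_bound
    {R : Type*} [Fintype R] [DecidableEq R]
    (B : Matrix R R ℝ) (hBdiag : ∀ x, B x x = 0)
    (a b : R) (η : ℝ)
    (hη : η = max (max
      (Finset.univ.sup' ⟨a, Finset.mem_univ a⟩
        (fun x => ∑ y ∈ Finset.univ \ {x}, |B x y|))
      (Finset.univ.sup' ⟨a, Finset.mem_univ a⟩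
        (fun y => ∑ x ∈ Finset.univ \ {y}, |B x y|))) 1)
    (Bt : Matrix R R ℝ) (hBt : ∀ x y, 0 ≤ Bt x y)
    (T : ℝ) (hT : 0 < T) (l : R → ℝ) (hl : ∀ x, 0 < l x) (hlT : ∑ x, l x = T) :
    (ddet ((-B).map (fun c => (c : ℂ))) a b (GM Bt) l).im = 0 ∧
    (ddet ((-B).map (fun c => (c : ℂ))) a b (GM Bt) l).re ≤
      Real.exp (∑ x, ∑ y, Bt x y * Real.sqrt (l x * l y)) *
        (∏ x ∈ (Finset.univ : Finset R) \ {a, b}, Real.sqrt (T / l x)) *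
        η ^ (Fintype.card R - 1) *
        Real.exp ((η⁻¹ + (4 * η ^ 2 * T)⁻¹) * ∑ x, ∑ y, Bt x y) := by
  have h1 : 1 ≤ η := by rw [hη]; exact le_max_right _ _
  have h0 : 0 < η := by linarith
  have hB : ∀ x, ∑ y, |B x y| ≤ η := by
    intro x
    have e : ∑ y, |B x y| = ∑ y ∈ Finset.univ \ {x}, |B x y| := by
      symm
      apply Finset.sum_subset (Finset.subset_univ _)
      intro y _ hy
      have : y = x := by simpa using hy
      simp [this, hBdiag]
    rw [e, hη]
    exact ((Finset.le_sup' (fun x => ∑ y ∈ Finset.univ \ {x}, |B x y|) (Finset.mem_univ x)).trans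
      (le_max_left _ _)).trans (le_max_left _ _)
  clear hη
  have hlT' : ∀ x, l x ≤ T := fun x => by
    rw [← hlT]
    exact Finset.single_le_sum (f := l) (fun i _ => (hl i).le) (Finset.mem_univ x)
  obtain ⟨c, k, hc, hck⟩ := aux_GM_series Bt hBt
  have hs : ∀ l : R → ℝ, (∀ x, 0 < l x) → Summable fun j => c j * ∏ x, l x ^ k j x :=
    fun l hl => Complex.summable_ofReal.mp (hck l hl).summable
  have hf : ∀ l : R → ℝ, (∀ x, 0 < l x) →
      GM Bt l = ((∑' j, c j * ∏ x, l x ^ k j x : ℝ) : ℂ) := fun l hl => by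
    rw [Complex.ofReal_tsum]; exact (hck l hl).tsum_eq.symm
  set W := (Finset.univ : Finset R) \ {a, b} with hW
  let t : Finset R → (Σ m : ℕ, (Fin m → R × R)) → ℝ := fun Q j =>
    (c j * ∏ x, l x ^ k j x) * ∏ x ∈ Q, ((k j x : ℝ) / l x)
  have ht0 : ∀ Q j, 0 ≤ t Q j := fun Q j =>
    mul_nonneg (mul_nonneg (hc j) (Finset.prod_nonneg fun x _ => pow_nonneg (hl x).le _))
      (Finset.prod_nonneg fun x _ => div_nonneg (Nat.cast_nonneg _) (hl x).le)
  have hmp : ∀ Q : Finset R, Summable (t Q) ∧ mpart Q (GM Bt) l = ((∑' j, t Q j : ℝ) : ℂ) := by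
    intro Q
    obtain ⟨g1, g2⟩ := aux_series_mpart c hc k hs (GM Bt) hf Q.toList Q.nodup_toList
    have g1 := g1 l hl
    have g2 := g2 l hl
    have e : ∀ j, (c j * ∏ x ∈ Q.toList.toFinset, (k j x : ℝ)) *
        ∏ x, l x ^ (if x ∈ Q.toList then k j x - 1 else k j x) = t Q j := by
      intro j
      simp only [Finset.toList_toFinset, Finset.mem_toList, t]
      have e1 : ∀ f : R → ℝ, ∏ x ∈ Q, f x = ∏ x, if x ∈ Q then f x else 1 := by
        intro f; simp
      rw [e1, e1, mul_assoc, mul_assoc, ← Finset.prod_mul_distrib, ← Finset.prod_mul_distrib]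
      congr 1
      apply Finset.prod_congr rfl
      intro x _
      have := (hl x).ne'
      split_ifs
      · rcases hk : k j x with _ | n
        · simp
        · simp only [Nat.add_sub_cancel, pow_succ]; field_simp
      · simp
    simp only [e] at g1 g2
    exact ⟨g1, g2⟩
  unfold ddet
  rw [← hW]
  have hQb : ∀ Q ∈ W.powerset, b ∈ (Finset.univ : Finset R) \ Q := by
    intro Q hQ
    simp only [Finset.mem_powerset] at hQ
    simp only [Finset.mem_sdiff, Finset.mem_univ, true_and]
    intro hb
    have := hQ hb
    simp [hW] at this
  constructor
  · rw [Complex.im_sum]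
    apply Finset.sum_eq_zero
    intro Q _
    obtain ⟨r, hr⟩ := aux_cof_real B a b (Finset.univ \ Q)
    rw [hr, (hmp Q).2, ← Complex.ofReal_mul, Complex.ofReal_im]
  set n := Fintype.card R with hn
  let l' : R → ℝ := fun x => l x * (1 + 1 / (η * Real.sqrt (l x) * Real.sqrt T))
  have hl' : ∀ x, 0 < l' x := fun x => by
    have := hl x
    have := Real.sqrt_pos.mpr (hl x)
    have := Real.sqrt_pos.mpr hT
    simp only [l']
    positivity
  have hll' : ∀ x, l x ≤ l' x := fun x => by
    have := hl x
    have := Real.sqrt_pos.mpr (hl x)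
    have := Real.sqrt_pos.mpr hT
    simp only [l']
    apply le_mul_of_one_le_right (hl x).le
    have : 0 ≤ 1 / (η * Real.sqrt (l x) * Real.sqrt T) := by positivity
    linarith
  set P := ∏ x ∈ W, Real.sqrt (T / l x) with hP
  have hP0 : 0 ≤ P := Finset.prod_nonneg fun _ _ => Real.sqrt_nonneg _
  -- termwise bound
  have hterm : ∀ j, ∑ Q ∈ W.powerset, η ^ (n - 1) * (∏ x ∈ Q, η⁻¹) * t Q j ≤
      (P * η ^ (n - 1)) * (c j * ∏ x, l' x ^ k j x) := by
    intro j
    have e : ∑ Q ∈ W.powerset, η ^ (n - 1) * (∏ x ∈ Q, η⁻¹) * t Q j =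
        η ^ (n - 1) * c j * ((∏ x ∈ W, (1 + (k j x / l x) / η)) * ∏ x, l x ^ k j x) := by
      rw [Finset.prod_one_add, Finset.sum_mul, Finset.mul_sum]
      apply Finset.sum_congr rfl
      intro Q _
      simp only [t, div_eq_mul_inv _ η, Finset.prod_mul_distrib]
      ring
    rw [e]
    have e2 : (∏ x ∈ W, (1 + (k j x / l x) / η)) * ∏ x, l x ^ k j x ≤
        P * ∏ x, l' x ^ k j x := by
      have e1 : ∀ f : R → ℝ, ∏ x ∈ W, f x = ∏ x, if x ∈ W then f x else 1 := by
        intro f; rw [Finset.prod_ite_mem, Finset.univ_inter]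
      rw [hP, e1, e1, ← Finset.prod_mul_distrib, ← Finset.prod_mul_distrib]
      apply Finset.prod_le_prod
      · intro x _
        have := hl x
        split_ifs <;> positivity
      · intro x _
        split_ifs
        · exact aux_factor η T (l x) (k j x) h1 hT (hl x) (hlT' x)
        · rw [one_mul, one_mul]
          exact pow_le_pow_left₀ (hl x).le (hll' x) _
    calc _ ≤ η ^ (n - 1) * c j * (P * ∏ x, l' x ^ k j x) :=
          mul_le_mul_of_nonneg_left e2 (mul_nonneg (by positivity) (hc j))
      _ = _ := by ring
  have hcof : ∀ Q ∈ W.powerset,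
      ‖cofDet ((Finset.univ : Finset R) \ Q) ((-B).map (fun c => (c : ℂ))) a b‖ ≤
        η ^ (n - 1) * (∏ x ∈ Q, η⁻¹) := by
    intro Q hQ
    refine (aux_cof_bound B a b η hB _ (hQb Q hQ)).trans_eq ?_
    have hpos : 0 < #((Finset.univ : Finset R) \ Q) := Finset.card_pos.mpr ⟨b, hQb Q hQ⟩
    have hcard : #((Finset.univ : Finset R) \ Q) + #Q = n := by
      rw [Finset.card_sdiff_add_card_eq_card (Finset.subset_univ _), Finset.card_univ]
    have : n - 1 = (#((Finset.univ : Finset R) \ Q) - 1) + #Q := by omega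
    rw [this, Finset.prod_const, pow_add, mul_assoc, ← mul_pow, mul_inv_cancel₀ h0.ne', one_pow,
      mul_one]
  have hGl' : ∑' j, c j * ∏ x, l' x ^ k j x ≤
      Real.exp (∑ x, ∑ y, Bt x y * Real.sqrt (l x * l y)) *
        Real.exp ((η⁻¹ + (4 * η ^ 2 * T)⁻¹) * ∑ x, ∑ y, Bt x y) := by
    have e1 := aux_GM_norm Bt hBt l'
    rw [hf l' hl', Complex.norm_real] at e1
    refine (le_abs_self _).trans (e1.trans ?_)
    rw [← Real.exp_add]
    apply Real.exp_le_exp.mpr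
    rw [Finset.mul_sum, ← Finset.sum_add_distrib]
    apply Finset.sum_le_sum
    intro x _
    rw [Finset.mul_sum, ← Finset.sum_add_distrib]
    apply Finset.sum_le_sum
    intro y _
    have := mul_le_mul_of_nonneg_left
      (aux_sqrt η T (l x) (l y) h1 hT (hl x) (hlT' x) (hl y) (hlT' y)) (hBt x y)
    refine this.trans_eq ?_
    ring
  have hsumQ : ∀ Q ∈ W.powerset, Summable (fun j => η ^ (n - 1) * (∏ x ∈ Q, η⁻¹) * t Q j) :=
    fun Q _ => (hmp Q).1.mul_left _
  refine (Complex.re_le_norm _).trans ((norm_sum_le _ _).trans ?_)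
  calc ∑ Q ∈ W.powerset, ‖cofDet ((Finset.univ : Finset R) \ Q) ((-B).map (fun c => (c : ℂ))) a b *
          mpart Q (GM Bt) l‖
      ≤ ∑ Q ∈ W.powerset, ∑' j, η ^ (n - 1) * (∏ x ∈ Q, η⁻¹) * t Q j := by
        apply Finset.sum_le_sum
        intro Q hQ
        rw [norm_mul, (hmp Q).2, Complex.norm_real, Real.norm_of_nonneg (tsum_nonneg (ht0 Q)),
          tsum_mul_left]
        exact mul_le_mul_of_nonneg_right (hcof Q hQ) (tsum_nonneg (ht0 Q))
    _ = ∑' j, ∑ Q ∈ W.powerset, η ^ (n - 1) * (∏ x ∈ Q, η⁻¹) * t Q j :=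
        (Summable.tsum_finsetSum hsumQ).symm
    _ ≤ ∑' j, (P * η ^ (n - 1)) * (c j * ∏ x, l' x ^ k j x) :=
        Summable.tsum_le_tsum hterm (summable_sum hsumQ) ((hs l' hl').mul_left _)
    _ = (P * η ^ (n - 1)) * ∑' j, c j * ∏ x, l' x ^ k j x := tsum_mul_left
    _ ≤ (P * η ^ (n - 1)) * (Real.exp (∑ x, ∑ y, Bt x y * Real.sqrt (l x * l y)) *
        Real.exp ((η⁻¹ + (4 * η ^ 2 * T)⁻¹) * ∑ x, ∑ y, Bt x y)) :=
        mul_le_mul_of_nonneg_left hGl' (by positivity)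
    _ = _ := by ring

end
end

section
/- Let R be a finite set, a, b ∈ R, let A be a symmetric real R×R matrix with A_{x,y} ≥ 0 for all x ≠ y, let B be its off-diagonal part (B_{x,y} = A_{x,y} for x ≠ y, B_{x,x} = 0), and set η_R = max{ max_{x∈R} Σ_{y∈R∖{x}} |B_{x,y}|, 1 } (which equals the symmetric maximum of row and column sums). Fix T > 0 and l ∈ (0,∞)^R with Σ_{x∈R} l_x = T. Then the local-time density ρ_{ab}^{(R)}(l) is a real number and satisfies ρ_{ab}^{(R)}(l) ≤ exp(Σ_{x,y∈R} √(l_x) A_{x,y} √(l_y)) · (∏_{x∈R∖{a,b}} √(T/l_x)) · η_R^{|R|−1} · exp( |R| · (1 + (4 η_R T)^{-1}) ). -/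
open MeasureTheory Finset

noncomputable section

lemma det_norm_le_aux {n : Type*} [Fintype n] [DecidableEq n] (M : Matrix n n ℂ) :
    ‖M.det‖ ≤ ∏ i, ∑ j, ‖M i j‖ := by
  rw [← Matrix.det_transpose, Matrix.det_apply]
  refine (norm_sum_le _ _).trans ?_
  have h1 : ∀ σ : Equiv.Perm n, ‖Equiv.Perm.sign σ • ∏ i, M.transpose (σ i) i‖
      = ∏ i, ‖M i (σ i)‖ := by
    intro σ
    rcases Int.units_eq_one_or (Equiv.Perm.sign σ) with h | h <;> simp [h]
  simp_rw [h1]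
  rw [Finset.prod_univ_sum]
  have h2 : ∑ σ : Equiv.Perm n, ∏ i, ‖M i (σ i)‖
      = ∑ f ∈ (Finset.univ : Finset (Equiv.Perm n)).map
          (⟨fun σ => (σ : n → n), DFunLike.coe_injective⟩ : Equiv.Perm n ↪ (n → n)),
            ∏ i, ‖M i (f i)‖ := by
    rw [Finset.sum_map]; rfl
  rw [h2]
  apply Finset.sum_le_sum_of_subset_of_nonneg
  · intro f _; simp
  · intro f _ _; positivity

lemma cofDet_expand {α : Type*} [Fintype α] [DecidableEq α] (M : Matrix α α ℂ) (a b : α)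
    (v : α → ℂ) :
    ∑ Q ∈ ((Finset.univ : Finset α) \ {a, b}).powerset,
      cofDet ((Finset.univ : Finset α) \ Q) M a b * ∏ x ∈ Q, v x =
    (Matrix.of fun x y : α => if x = b then (if y = a then (1:ℂ) else 0)
      else (if y = a then 0 else M x y + if x = y then v x else 0)).det := by
  set N : Matrix α α ℂ := Matrix.of fun x y : α => if x = b then (if y = a then (1:ℂ) else 0)
      else (if y = a then 0 else M x y) with hN
  set D : Matrix α α ℂ := Matrix.of fun x y : α =>
      if x = a ∨ x = b then 0 else if x = y then v x else 0 with hD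
  have e : (Matrix.of fun x y : α => if x = b then (if y = a then (1:ℂ) else 0)
      else (if y = a then 0 else M x y + if x = y then v x else 0)) = D + N := by
    ext x y
    simp only [hN, hD, Matrix.add_apply, Matrix.of_apply]
    by_cases h1 : x = b <;> by_cases h2 : y = a <;> by_cases h3 : x = a <;>
      by_cases h4 : x = y <;> simp_all [add_comm]
  rw [e]
  have := MultilinearMap.map_add_univ
    (Matrix.detRowAlternating (R := ℂ) (n := α)).toMultilinearMap D N
  change (D + N).det = ∑ s : Finset α, Matrix.det (Matrix.of (s.piecewise (fun i => D i) (fun i => N i))) at this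
  rw [this]
  symm
  rw [← Finset.sum_subset (Finset.subset_univ ((Finset.univ : Finset α) \ {a, b}).powerset)]
  · apply Finset.sum_congr rfl
    intro Q hQ
    have hQ' : ∀ x ∈ Q, ¬ (x = a ∨ x = b) := by
      intro x hx
      have := Finset.mem_powerset.1 hQ hx
      simpa using this
    rw [Matrix.twoBlockTriangular_det _ (fun x => x ∉ Q)]
    · congr 1
      · unfold cofDet
        rw [← Matrix.det_submatrix_equiv_self
          (Equiv.subtypeEquivRight (p := fun x => x ∈ (Finset.univ : Finset α) \ Q)
            (q := fun x => x ∉ Q) (by simp))]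
        congr 1
        ext x y
        have hx : (x : α) ∉ Q := (Finset.mem_sdiff.1 x.2).2
        simp [Matrix.toSquareBlockProp, Finset.piecewise, hx, hN]
      · have : (Matrix.toSquareBlockProp (Matrix.of (Q.piecewise (fun i => D i) (fun i => N i))) fun i => ¬ i ∉ Q)
            = Matrix.diagonal (fun x => v x.1) := by
          ext x y
          have hx : (x : α) ∈ Q := by have := x.2; simpa using this
          have h2 := hQ' _ hx
          simp [Matrix.toSquareBlockProp, Finset.piecewise, hx, hD, h2, Matrix.diagonal_apply,
            Subtype.ext_iff]
        rw [this, Matrix.det_diagonal]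
        symm
        apply Finset.prod_subtype
        simp
    · intro i hi j hj
      have hi : i ∈ Q := by simpa using hi
      have : i ≠ j := by rintro rfl; exact hj hi
      simp [Finset.piecewise, hi, hD, this]
  · intro s _ hs
    have : ∃ x ∈ s, x = a ∨ x = b := by
      by_contra hcon
      push Not at hcon
      apply hs
      rw [Finset.mem_powerset]
      intro x hx
      simpa using hcon x hx
    obtain ⟨x, hx, hxab⟩ := this
    apply Matrix.det_eq_zero_of_row_eq_zero x
    intro j
    simp [Finset.piecewise, hx, hD, hxab]

lemma hasFDerivAt_param {𝕜 H Θ : Type*} [RCLike 𝕜] [NormedAddCommGroup H] [NormedSpace 𝕜 H]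
    [NormedSpace 𝕜 ℂ] [ProperSpace H]
    [TopologicalSpace Θ] [MeasurableSpace Θ] [OpensMeasurableSpace Θ]
    [T2Space Θ] [SecondCountableTopology Θ]
    (μ : Measure Θ) [IsFiniteMeasureOnCompacts μ] (K : Set Θ) (hK : IsCompact K)
    (F : H → Θ → ℂ) (F' : H → Θ → H →L[𝕜] ℂ)
    (hF : Continuous (fun p : H × Θ => F p.1 p.2))
    (hF' : Continuous (fun p : H × Θ => F' p.1 p.2))
    (hd : ∀ z θ, HasFDerivAt (fun z => F z θ) (F' z θ) z) (z₀ : H) :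
    HasFDerivAt (fun z => ∫ θ in K, F z θ ∂μ) (∫ θ in K, F' z₀ θ ∂μ) z₀ := by
  obtain ⟨C, hC⟩ := ((isCompact_closedBall z₀ 1).prod hK).exists_bound_of_continuousOn
    hF'.continuousOn
  have hFc : ∀ z, Continuous (F z) := fun z => hF.comp (Continuous.prodMk_right z)
  have hFc' : ∀ z, Continuous (F' z) := fun z => hF'.comp (Continuous.prodMk_right z)
  apply hasFDerivAt_integral_of_dominated_of_fderiv_le (s := Metric.closedBall z₀ 1)
    (bound := fun _ => C)
  · exact Metric.closedBall_mem_nhds _ one_pos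
  · exact Filter.Eventually.of_forall fun z => (hFc z).aestronglyMeasurable
  · exact (hFc z₀).continuousOn.integrableOn_compact hK
  · have := (hFc' z₀).continuousOn.integrableOn_compact (μ := μ) hK
    exact this.aestronglyMeasurable
  · rw [ae_restrict_iff' hK.measurableSet]
    exact Filter.Eventually.of_forall fun θ hθ z hz => hC (z, θ) ⟨hz, hθ⟩
  · have : IntegrableOn (fun _ : Θ => C) K μ := continuousOn_const.integrableOn_compact hK
    exact this
  · exact Filter.Eventually.of_forall fun θ z _ => hd z θ

abbrev boxK (α : Type*) : Set (α → ℝ) := Set.univ.pi (fun _ : α => Set.Icc (0:ℝ) (2 * Real.pi))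

lemma boxK_compact (α : Type*) : IsCompact (boxK α) := isCompact_univ_pi fun _ => isCompact_Icc

lemma box_shift {α : Type*} [Fintype α] [DecidableEq α] (C : α → α → ℂ) (s : α → ℝ) :
    ∫ θ in boxK α, Complex.exp (∑ x, ∑ y, C x y *
        Complex.exp (Complex.I * (((θ x + s x : ℝ) : ℂ) - ((θ y + s y : ℝ) : ℂ)))) =
    ∫ θ in boxK α, Complex.exp (∑ x, ∑ y, C x y *
        Complex.exp (Complex.I * ((θ x : ℂ) - (θ y : ℂ)))) := by
  have : Fact (0 < 2 * Real.pi) := ⟨by positivity⟩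
  let Φ : (α → AddCircle (2 * Real.pi)) → ℂ := fun t =>
    Complex.exp (∑ x, ∑ y, C x y * ((t x - t y).toCircle : ℂ))
  have hΦc : Continuous Φ := by
    have h : Continuous (fun t : AddCircle (2 * Real.pi) => (t.toCircle : ℂ)) :=
      continuous_subtype_val.comp AddCircle.continuous_toCircle
    refine Complex.continuous_exp.comp (continuous_finsetSum _ fun x _ =>
      continuous_finsetSum _ fun y _ => continuous_const.mul (h.comp ?_))
    fun_prop
  have hval : ∀ u : α → ℝ, Φ (fun x => (u x : AddCircle (2 * Real.pi))) =
      Complex.exp (∑ x, ∑ y, C x y * Complex.exp (Complex.I * ((u x : ℂ) - (u y : ℂ)))) := by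
    intro u
    simp only [Φ]
    congr 1
    refine Finset.sum_congr rfl fun x _ => Finset.sum_congr rfl fun y _ => ?_
    rw [← AddCircle.coe_sub, AddCircle.toCircle_apply_mk, Circle.coe_exp]
    congr 2
    have : (2 * Real.pi) ≠ 0 := by positivity
    rw [div_self this]
    push_cast
    ring
  have hmp : MeasurePreserving (fun (u : α → ℝ) (x : α) => (u x : AddCircle (2 * Real.pi)))
      (volume.restrict (boxK α)) volume := by
    have h1 := measurePreserving_pi
      (fun _ : α => (volume : Measure ℝ).restrict (Set.Ioc 0 (0 + 2 * Real.pi)))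
      (fun _ : α => (volume : Measure (AddCircle (2 * Real.pi))))
      (fun _ => AddCircle.measurePreserving_mk (2 * Real.pi) 0)
    rw [← Measure.restrict_pi_pi] at h1
    have h2 : (volume : Measure (α → ℝ)).restrict (boxK α) =
        (Measure.pi fun _ : α => (volume : Measure ℝ)).restrict
          (Set.univ.pi fun _ => Set.Ioc 0 (0 + 2 * Real.pi)) := by
      rw [boxK, Set.pi_univ_Icc]
      exact (Measure.restrict_congr_set (by
        simpa [volume_pi] using Measure.univ_pi_Ioc_ae_eq_Icc (μ := fun _ : α => (volume : Measure ℝ))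
          (f := fun _ => 0) (g := fun _ => 2 * Real.pi))).symm
    rw [h2]
    exact h1
  have key : ∀ Ψ : (α → AddCircle (2 * Real.pi)) → ℂ, Continuous Ψ →
      ∫ θ in boxK α, Ψ (fun x => (θ x : AddCircle (2 * Real.pi))) = ∫ t, Ψ t := by
    intro Ψ hΨ
    rw [← hmp.map_eq, integral_map hmp.measurable.aemeasurable hΨ.aestronglyMeasurable]
  have e1 := key Φ hΦc
  have e2 := key (fun t => Φ (t + fun x => (s x : AddCircle (2 * Real.pi))))
    (hΦc.comp (by fun_prop))
  rw [integral_add_right_eq_self, ← e1] at e2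
  simp_rw [hval] at e2
  rw [← e2]
  congr 1
  ext θ
  rw [← hval]
  congr 1

lemma box_cshift {α : Type*} [Fintype α] [DecidableEq α] (C : α → α → ℂ) (v : α → ℝ) (z w : ℂ) :
    ∫ θ in boxK α, Complex.exp (∑ x, ∑ y, (C x y * Complex.exp (Complex.I * z * (v x - v y))) *
        Complex.exp (Complex.I * ((θ x : ℂ) - (θ y : ℂ)))) =
    ∫ θ in boxK α, Complex.exp (∑ x, ∑ y, (C x y * Complex.exp (Complex.I * w * (v x - v y))) *
        Complex.exp (Complex.I * ((θ x : ℂ) - (θ y : ℂ)))) := by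
  let S : ℂ → (α → ℝ) → ℂ := fun z θ => ∑ x, ∑ y,
    (C x y * Complex.exp (Complex.I * z * (v x - v y))) *
        Complex.exp (Complex.I * ((θ x : ℂ) - (θ y : ℂ)))
  let S' : ℂ → (α → ℝ) → ℂ := fun z θ => ∑ x, ∑ y,
    (C x y * (Complex.exp (Complex.I * z * (v x - v y)) * (Complex.I * (v x - v y)))) *
        Complex.exp (Complex.I * ((θ x : ℂ) - (θ y : ℂ)))
  have hSd : ∀ z θ, HasDerivAt (fun z => S z θ) (S' z θ) z := by
    intro z θ
    refine HasDerivAt.fun_sum fun x _ => HasDerivAt.fun_sum fun y _ => ?_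
    refine HasDerivAt.mul_const (HasDerivAt.const_mul _ (HasDerivAt.cexp ?_)) _
    simpa using ((hasDerivAt_id z).const_mul Complex.I).mul_const ((v x : ℂ) - v y)
  have hSc : Continuous (fun p : ℂ × (α → ℝ) => S p.1 p.2) := by fun_prop
  have hSc' : Continuous (fun p : ℂ × (α → ℝ) => S' p.1 p.2) := by fun_prop
  let h : ℂ → ℂ := fun z => ∫ θ in boxK α, Complex.exp (S z θ)
  have hdiff : Differentiable ℂ h := by
    intro z₀
    refine (hasFDerivAt_param (𝕜 := ℂ) volume (boxK α) (boxK_compact α)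
      (fun z θ => Complex.exp (S z θ))
      (fun z θ => ContinuousLinearMap.toSpanSingleton ℂ (Complex.exp (S z θ) * S' z θ))
      (by fun_prop) ?_ ?_ z₀).differentiableAt
    · have : Continuous (fun p : ℂ × (α → ℝ) => Complex.exp (S p.1 p.2) * S' p.1 p.2) := by
        fun_prop
      exact (ContinuousLinearMap.toSpanSingletonCLE (𝕜 := ℂ) (E := ℂ)).continuous.comp this
    · intro z θ
      exact (hSd z θ).cexp.hasFDerivAt
  have hinv : ∀ (z : ℂ) (t : ℝ), h (z + t) = h z := by
    intro z t
    have := box_shift (fun x y => C x y * Complex.exp (Complex.I * z * (v x - v y)))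
      (fun x => t * v x)
    simp only [h, S]
    rw [← this]
    congr 1
    ext θ
    congr 1
    refine Finset.sum_congr rfl fun x _ => Finset.sum_congr rfl fun y _ => ?_
    rw [mul_assoc, mul_assoc (C x y), ← Complex.exp_add, ← Complex.exp_add]
    congr 2
    push_cast
    ring
  have hder : ∀ z, deriv h z = 0 := by
    intro z
    have h1 : HasDerivAt h (deriv h z) (z + ((0:ℝ):ℂ)) := by simpa using (hdiff z).hasDerivAt
    have h2 : HasDerivAt (fun t : ℝ => z + (t:ℂ)) 1 0 := by
      simpa using (Complex.ofRealCLM.hasDerivAt (x := (0:ℝ))).const_add z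
    have h3 := HasDerivAt.comp (𝕜 := ℝ) (𝕜' := ℂ) 0 h1 h2
    have h4 : (h ∘ fun t : ℝ => z + (t:ℂ)) = fun _ => h z := by
      ext t; exact hinv z t
    rw [h4] at h3
    simpa using h3.unique (hasDerivAt_const _ _)
  exact is_const_of_deriv_eq_zero hdiff hder z w

/-- The tilted potential. -/
def VV {α : Type*} [Fintype α] (A : Matrix α α ℝ) (r : α → ℝ) (x : α) (θ : α → ℝ) : ℂ :=
  ∑ y, (A x y : ℂ) * ((r y / r x : ℝ) : ℂ) * Complex.exp (Complex.I * ((θ x : ℂ) - (θ y : ℂ)))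

lemma VV_cont {α : Type*} [Fintype α] (A : Matrix α α ℝ) (r : α → ℝ) (x : α) :
    Continuous (VV A r x) := by
  unfold VV; fun_prop

lemma GM_tilt {α : Type*} [Fintype α] [DecidableEq α] (A : Matrix α α ℝ) (r m : α → ℝ)
    (hr : ∀ x, 0 < r x) (hm : ∀ x, 0 < m x) :
    GM A m = ((2 * Real.pi : ℂ) ^ (Fintype.card α))⁻¹ *
      ∫ θ in boxK α, Complex.exp (∑ x, (m x : ℂ) * VV A r x θ) := by
  unfold GM
  congr 1
  have h := box_cshift (fun x y => (A x y : ℂ) * (Real.sqrt (m x * m y) : ℂ))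
    (fun x => Real.log (Real.sqrt (m x) / r x)) 0 (-Complex.I)
  simp only [mul_zero, zero_mul, Complex.exp_zero, mul_one] at h
  rw [h]
  congr 1
  ext θ
  congr 1
  refine Finset.sum_congr rfl fun x _ => ?_
  rw [VV, Finset.mul_sum]
  refine Finset.sum_congr rfl fun y _ => ?_
  rw [← mul_assoc, ← mul_assoc]
  congr 1
  have e : Complex.I * -Complex.I = 1 := by simp
  rw [e, one_mul, ← Complex.ofReal_sub, ← Complex.ofReal_exp]
  norm_cast
  have p1 := Real.sqrt_pos.2 (hm x)
  have p2 := Real.sqrt_pos.2 (hm y)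
  have q1 := hr x
  have q2 := hr y
  rw [Real.exp_sub, Real.exp_log (by positivity), Real.exp_log (by positivity),
    Real.sqrt_mul (hm x).le]
  have := Real.mul_self_sqrt (hm x).le
  field_simp
  rw [sq, this]

lemma pd_tilt {α : Type*} [Fintype α] [DecidableEq α] (P : (α → ℝ) → ℂ) (hP : Continuous P)
    (V : α → (α → ℝ) → ℂ) (hV : ∀ x, Continuous (V x)) (c : ℂ) (x₀ : α) (m : α → ℝ) :
    pd x₀ (fun m => c * ∫ θ in boxK α, P θ * Complex.exp (∑ x, (m x : ℂ) * V x θ)) m =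
      c * ∫ θ in boxK α, (V x₀ θ * P θ) * Complex.exp (∑ x, (m x : ℂ) * V x θ) := by
  let F' : (α → ℝ) → (α → ℝ) → (α → ℝ) →L[ℝ] ℂ := fun m θ =>
    ∑ x, (P θ * Complex.exp (∑ x, (m x : ℂ) * V x θ) * V x θ) •
      (Complex.ofRealCLM ∘L (ContinuousLinearMap.proj (R := ℝ) (φ := fun _ : α => ℝ) x))
  have hF'c : Continuous (fun p : (α → ℝ) × (α → ℝ) => F' p.1 p.2) := by
    refine continuous_finsetSum _ fun x _ => ?_
    have : Continuous (fun p : (α → ℝ) × (α → ℝ) =>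
      P p.2 * Complex.exp (∑ x, (p.1 x : ℂ) * V x p.2) * V x p.2) := by fun_prop
    exact this.smul continuous_const
  have hd := hasFDerivAt_param (𝕜 := ℝ) volume (boxK α) (boxK_compact α)
    (fun (m θ : α → ℝ) => P θ * Complex.exp (∑ x, (m x : ℂ) * V x θ)) F'
    (by fun_prop) hF'c ?_ m
  · unfold pd
    rw [(hd.const_mul c).fderiv]
    have hi : Integrable (F' m) (volume.restrict (boxK α)) :=
      ((hF'c.comp (Continuous.prodMk_right m)).continuousOn.integrableOn_compact
        (boxK_compact α))
    simp only [_root_.smul_apply, smul_eq_mul]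
    rw [ContinuousLinearMap.integral_apply hi]
    congr 2
    ext θ
    simp only [F', _root_.sum_apply, _root_.smul_apply,
      ContinuousLinearMap.comp_apply, ContinuousLinearMap.proj_apply, Complex.ofRealCLM_apply]
    rw [Finset.sum_eq_single x₀]
    · simp; ring
    · intro y _ hy; simp [hy]
    · simp
  · intro m θ
    have h1 : HasFDerivAt (fun m : α → ℝ => ∑ x, (m x : ℂ) * V x θ)
        (∑ x, V x θ • (Complex.ofRealCLM ∘L
          (ContinuousLinearMap.proj (R := ℝ) (φ := fun _ : α => ℝ) x))) m := by
      refine HasFDerivAt.fun_sum fun x _ => ?_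
      exact (Complex.ofRealCLM ∘L
          (ContinuousLinearMap.proj (R := ℝ) (φ := fun _ : α => ℝ) x)).hasFDerivAt.mul_const (V x θ)
    have e : F' m θ = P θ • Complex.exp (∑ x, (m x : ℂ) * V x θ) • ∑ x, V x θ •
        (Complex.ofRealCLM ∘L
          (ContinuousLinearMap.proj (R := ℝ) (φ := fun _ : α => ℝ) x)) := by
      simp only [F', Finset.smul_sum, smul_smul]
      refine Finset.sum_congr rfl fun x _ => ?_
      congr 1
      ring
    rw [e]
    exact h1.cexp.const_mul (P θ)

lemma foldr_tilt {α : Type*} [Fintype α] [DecidableEq α] (A : Matrix α α ℝ) (r : α → ℝ)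
    (hr : ∀ x, 0 < r x) (L : List α) : ∀ m : α → ℝ, (∀ x, 0 < m x) →
    L.foldr pd (GM A) m = ((2 * Real.pi : ℂ) ^ (Fintype.card α))⁻¹ *
      ∫ θ in boxK α, (L.map (fun x => VV A r x θ)).prod *
        Complex.exp (∑ x, (m x : ℂ) * VV A r x θ) := by
  induction L with
  | nil => intro m hm; simpa using GM_tilt A r m hr hm
  | cons x₀ L ih =>
    intro m hm
    have hc : Continuous fun θ => (L.map (fun x => VV A r x θ)).prod :=
      continuous_list_prod L fun x _ => VV_cont A r x
    have := pd_tilt _ hc (VV A r) (VV_cont A r) (((2 * Real.pi : ℂ) ^ (Fintype.card α))⁻¹) x₀ m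
    simp only [List.foldr_cons, List.map_cons, List.prod_cons]
    rw [← this]
    unfold pd
    congr 1
    apply Filter.EventuallyEq.fderiv_eq
    have hopen : ∀ᶠ m' in nhds m, ∀ x, 0 < m' x := by
      rw [Filter.eventually_all]
      intro x
      exact (continuous_apply x).continuousAt.eventually (lt_mem_nhds (hm x))
    filter_upwards [hopen] with m' hm'
    exact ih m' hm'

lemma GM_real {α : Type*} [Fintype α] [DecidableEq α] (A : Matrix α α ℝ)
    (hA : ∀ x y, A x y = A y x) (m : α → ℝ) :
    (starRingEnd ℂ) (GM A m) = GM A m := by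
  unfold GM
  rw [map_mul, ← integral_conj]
  congr 1
  · have h2 : (starRingEnd ℂ) 2 = 2 := Complex.conj_ofNat 2
    simp [h2]
  · congr 1
    ext θ
    rw [← Complex.exp_conj]
    congr 1
    simp only [map_sum, map_mul, Complex.conj_ofReal, ← Complex.exp_conj, map_sub, Complex.conj_I]
    rw [Finset.sum_comm]
    refine Finset.sum_congr rfl fun x _ => Finset.sum_congr rfl fun y _ => ?_
    rw [hA y x, mul_comm (m y)]
    congr 2
    ring

lemma pd_real {α : Type*} [Fintype α] [DecidableEq α] (x : α) (f : (α → ℝ) → ℂ)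
    (hf : ∀ m, (starRingEnd ℂ) (f m) = f m) (m : α → ℝ) :
    (starRingEnd ℂ) (pd x f m) = pd x f m := by
  have h1 : (Complex.conjCLE : ℂ → ℂ) ∘ f = f := by
    ext m; exact hf m
  have h2 := Complex.conjCLE.comp_fderiv (f := f) (x := m)
  rw [h1] at h2
  unfold pd
  conv_rhs => rw [h2]
  rfl

lemma mpart_real {α : Type*} [Fintype α] [DecidableEq α] (Q : Finset α) (f : (α → ℝ) → ℂ)
    (hf : ∀ m, (starRingEnd ℂ) (f m) = f m) (m : α → ℝ) :
    (starRingEnd ℂ) (mpart Q f m) = mpart Q f m := by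
  unfold mpart
  induction Q.toList generalizing m with
  | nil => exact hf m
  | cons x L ih => exact pd_real x _ ih m

lemma rho_real {α : Type*} [Fintype α] [DecidableEq α] (A : Matrix α α ℝ)
    (hA : ∀ x y, A x y = A y x) (a b : α) (l : α → ℝ) : (rho A a b l).im = 0 := by
  rw [← Complex.conj_eq_iff_im]
  unfold rho ddet
  rw [map_sum]
  refine Finset.sum_congr rfl fun Q _ => ?_
  rw [map_mul, mpart_real _ _ (GM_real A hA)]
  congr 1
  unfold cofDet
  rw [RingHom.map_det]
  congr 1
  ext x y
  simp only [RingHom.mapMatrix_apply, Matrix.map_apply, Matrix.of_apply]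
  split_ifs <;> simp

/-- The tilted cofactor matrix. -/
def NN {α : Type*} [Fintype α] [DecidableEq α] (A : Matrix α α ℝ) (r : α → ℝ) (a b : α)
    (θ : α → ℝ) : Matrix α α ℂ :=
  Matrix.of fun x y : α => if x = b then (if y = a then (1:ℂ) else 0)
      else (if y = a then 0 else ((-A).map (fun r => (r : ℂ))) x y +
        if x = y then VV A r x θ else 0)

lemma rho_formula {α : Type*} [Fintype α] [DecidableEq α] (A : Matrix α α ℝ) (a b : α)
    (r l : α → ℝ) (hr : ∀ x, 0 < r x) (hl : ∀ x, 0 < l x) :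
    rho A a b l = ((2 * Real.pi : ℂ) ^ (Fintype.card α))⁻¹ *
      ∫ θ in boxK α, (NN A r a b θ).det * Complex.exp (∑ x, (l x : ℂ) * VV A r x θ) := by
  have hV := VV_cont A r
  unfold rho ddet NN
  simp_rw [← cofDet_expand, Finset.sum_mul]
  rw [integral_finsetSum, Finset.mul_sum]
  · refine Finset.sum_congr rfl fun Q _ => ?_
    unfold mpart
    rw [foldr_tilt A r hr _ l hl]
    simp_rw [Finset.prod_map_toList, mul_assoc]
    rw [integral_const_mul]
    ring
  · intro Q _
    apply ContinuousOn.integrableOn_compact (boxK_compact α)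
    apply Continuous.continuousOn
    fun_prop

lemma row_offdiag {α : Type*} [Fintype α] [DecidableEq α] (A : Matrix α α ℝ) (r : α → ℝ)
    (hr : ∀ x, 0 < r x) (x : α) (θ : α → ℝ) :
    ‖-(A x x : ℂ) + VV A r x θ‖ ≤ ∑ y ∈ Finset.univ \ {x}, |A x y| * (r y / r x) := by
  have h : -(A x x : ℂ) + VV A r x θ = ∑ y ∈ Finset.univ \ {x},
      (A x y : ℂ) * ((r y / r x : ℝ) : ℂ) *
        Complex.exp (Complex.I * ((θ x : ℂ) - (θ y : ℂ))) := by
    rw [VV, ← Finset.sum_sdiff (Finset.subset_univ {x}), Finset.sum_singleton,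
      div_self (hr x).ne']
    simp
  rw [h]
  refine (norm_sum_le _ _).trans (Finset.sum_le_sum fun y _ => ?_)
  rw [norm_mul, norm_mul, mul_comm Complex.I, ← Complex.ofReal_sub,
    Complex.norm_exp_ofReal_mul_I, mul_one, Complex.norm_real, Complex.norm_real,
    Real.norm_eq_abs, Real.norm_eq_abs, abs_of_pos (div_pos (hr y) (hr x))]

lemma NN_det_le {α : Type*} [Fintype α] [DecidableEq α] (A : Matrix α α ℝ) (a b : α)
    (η : ℝ) (hη1 : 1 ≤ η) (hη : ∀ x, ∑ y ∈ Finset.univ \ {x}, |A x y| ≤ η)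
    (T : ℝ) (l : α → ℝ) (hl : ∀ x, 0 < l x) (hlT : ∀ x, l x ≤ T) (θ : α → ℝ) :
    ‖(NN A (fun x => Real.sqrt (l x)) a b θ).det‖ ≤
      (∏ x ∈ (Finset.univ : Finset α) \ {a, b}, Real.sqrt (T / l x)) *
        η ^ (Fintype.card α - 1) * 2 ^ (Fintype.card α) := by
  have hq : ∀ x, 1 ≤ Real.sqrt (T / l x) := by
    intro x
    rw [Real.one_le_sqrt, one_le_div (hl x)]
    exact hlT x
  have hrow : ∀ x, ∑ y, ‖NN A (fun x => Real.sqrt (l x)) a b θ x y‖ ≤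
      (if x ∈ (Finset.univ : Finset α) \ {a, b} then Real.sqrt (T / l x) else 1) *
        (if x = b then 1 else η) * 2 := by
    intro x
    by_cases hxb : x = b
    · have : ∑ y, ‖NN A (fun x => Real.sqrt (l x)) a b θ x y‖ = 1 := by
        rw [Finset.sum_eq_single a]
        · simp [NN, hxb]
        · intro y _ hy; simp [NN, hxb, hy]
        · simp
      rw [this]
      simp [hxb]
    · rw [← Finset.sum_sdiff (Finset.subset_univ {x}), Finset.sum_singleton]
      have h1 : ∑ y ∈ Finset.univ \ {x}, ‖NN A (fun x => Real.sqrt (l x)) a b θ x y‖ ≤ η := by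
        refine le_trans (Finset.sum_le_sum fun y hy => ?_) (hη x)
        have hxy : x ≠ y := by
          rintro rfl; simp at hy
        by_cases hya : y = a <;> simp [NN, hxb, hya, hxy]
      by_cases hxa : x = a
      · have h2 : ‖NN A (fun x => Real.sqrt (l x)) a b θ x x‖ = 0 := by
          simp [NN, hxb, hxa]
          intro h; exact absurd (hxa.trans h) hxb
        rw [h2]
        have hmem : x ∉ (Finset.univ : Finset α) \ {a, b} := by simp [hxa]
        rw [if_neg hmem, if_neg hxb]
        linarith
      · have h2 : ‖NN A (fun x => Real.sqrt (l x)) a b θ x x‖ ≤ η * Real.sqrt (T / l x) := by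
          have := row_offdiag A (fun x => Real.sqrt (l x)) (fun x => Real.sqrt_pos.2 (hl x)) x θ
          simp only [NN, hxb, hxa, Matrix.of_apply, if_false, if_true, Matrix.map_apply,
            Matrix.neg_apply, Complex.ofReal_neg]
          refine this.trans ?_
          refine le_trans (Finset.sum_le_sum (g := fun y => |A x y| * Real.sqrt (T / l x))
            fun y _ => ?_) ?_
          · apply mul_le_mul_of_nonneg_left _ (abs_nonneg _)
            rw [← Real.sqrt_div (hl y).le]
            apply Real.sqrt_le_sqrt
            have := hl x
            gcongr
            exact hlT y
          · rw [← Finset.sum_mul]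
            exact mul_le_mul_of_nonneg_right (hη x) (Real.sqrt_nonneg _)
        have hmem : x ∈ (Finset.univ : Finset α) \ {a, b} := by simp [hxa, hxb]
        rw [if_pos hmem, if_neg hxb]
        nlinarith [hq x]
  refine (det_norm_le_aux _).trans ?_
  refine (Finset.prod_le_prod (fun x _ => by positivity) (fun x _ => hrow x)).trans ?_
  rw [Finset.prod_mul_distrib, Finset.prod_mul_distrib]
  apply le_of_eq
  congr 1
  · congr 1
    · rw [Finset.prod_ite_mem, Finset.univ_inter]
    · rw [Finset.prod_ite]
      simp [Finset.filter_ne']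
  · simp

lemma exp_norm_le {α : Type*} [Fintype α] [DecidableEq α] (A : Matrix α α ℝ)
    (hA : ∀ x y, x ≠ y → 0 ≤ A x y) (l : α → ℝ) (hl : ∀ x, 0 < l x) (θ : α → ℝ) :
    ‖Complex.exp (∑ x, (l x : ℂ) * VV A (fun x => Real.sqrt (l x)) x θ)‖ ≤
      Real.exp (∑ x, ∑ y, Real.sqrt (l x) * A x y * Real.sqrt (l y)) := by
  rw [Complex.norm_exp]
  apply Real.exp_le_exp.2
  rw [Complex.re_sum]
  refine Finset.sum_le_sum fun x _ => ?_
  rw [VV, Finset.mul_sum, Complex.re_sum]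
  refine Finset.sum_le_sum fun y _ => ?_
  have e : (l x : ℂ) * ((A x y : ℂ) * ((Real.sqrt (l y) / Real.sqrt (l x) : ℝ) : ℂ) *
      Complex.exp (Complex.I * ((θ x : ℂ) - (θ y : ℂ)))) =
      ((Real.sqrt (l x) * A x y * Real.sqrt (l y) : ℝ) : ℂ) *
        Complex.exp (((θ x - θ y : ℝ) : ℂ) * Complex.I) := by
    rw [← mul_assoc]
    congr 1
    · norm_cast
      have p1 := Real.sqrt_pos.2 (hl x)
      have := Real.mul_self_sqrt (hl x).le
      field_simp
      rw [sq, this]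
      ring
    · push_cast
      rw [mul_comm]
  rw [e, Complex.re_ofReal_mul, Complex.exp_ofReal_mul_I_re]
  by_cases hxy : x = y
  · subst hxy; simp
  · have := hA x y hxy
    exact mul_le_of_le_one_right (by positivity) (Real.cos_le_one _)

/-- **Remark 3.2 (symmetric case of the pointwise upper bound).** Let `A` be symmetric
with nonnegative off-diagonal entries, `B` its off-diagonal part,
`η_R = max{max_x Σ_{y≠x}|B_{x,y}|, 1}`, `T > 0` and `l ∈ (0,∞)^R` with `Σ l_x = T`.
Then `ρ_{ab}^{(R)}(l)` is real and
`ρ_{ab}^{(R)}(l) ≤ e^{Σ_{x,y} √(l_x) A_{x,y} √(l_y)} (∏_{x∈R∖{a,b}} √(T/l_x))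
  η_R^{|R|−1} e^{|R|(1 + (4η_R T)⁻¹)}`. -/
theorem rho_pointwise_upper_bound_symmetric
    {R : Type*} [Fintype R] [DecidableEq R]
    (A B : Matrix R R ℝ)
    (hA_symm : ∀ x y, A x y = A y x)
    (hA_offdiag : ∀ x y, x ≠ y → 0 ≤ A x y)
    (hB : ∀ x y, B x y = if x = y then 0 else A x y)
    (a b : R) (η : ℝ)
    (hη : η = max
      (Finset.univ.sup' ⟨a, Finset.mem_univ a⟩
        (fun x => ∑ y ∈ Finset.univ \ {x}, |B x y|)) 1)
    (T : ℝ) (hT : 0 < T) (l : R → ℝ) (hl : ∀ x, 0 < l x) (hlT : ∑ x, l x = T) :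
    (rho A a b l).im = 0 ∧
    (rho A a b l).re ≤
      Real.exp (∑ x, ∑ y, Real.sqrt (l x) * A x y * Real.sqrt (l y)) *
        (∏ x ∈ (Finset.univ : Finset R) \ {a, b}, Real.sqrt (T / l x)) *
        η ^ (Fintype.card R - 1) *
        Real.exp ((Fintype.card R : ℝ) * (1 + (4 * η * T)⁻¹)) := by
  refine ⟨rho_real A hA_symm a b l, ?_⟩
  have hη1 : 1 ≤ η := hη ▸ le_max_right _ _
  have hηr : ∀ x, ∑ y ∈ Finset.univ \ {x}, |A x y| ≤ η := by
    intro x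
    have h1 : ∑ y ∈ Finset.univ \ {x}, |A x y| = ∑ y ∈ Finset.univ \ {x}, |B x y| := by
      refine Finset.sum_congr rfl fun y hy => ?_
      have hxy : x ≠ y := by
        rintro rfl; simp at hy
      rw [hB, if_neg hxy]
    rw [h1, hη]
    exact le_max_of_le_left (Finset.le_sup'
      (fun x => ∑ y ∈ Finset.univ \ {x}, |B x y|) (Finset.mem_univ x))
  have hlT' : ∀ x, l x ≤ T := by
    intro x
    rw [← hlT]
    exact Finset.single_le_sum (fun y _ => (hl y).le) (Finset.mem_univ x)
  set E := Real.exp (∑ x, ∑ y, Real.sqrt (l x) * A x y * Real.sqrt (l y)) with hE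
  set P := ∏ x ∈ (Finset.univ : Finset R) \ {a, b}, Real.sqrt (T / l x) with hP
  have hP0 : 0 ≤ P := Finset.prod_nonneg fun x _ => Real.sqrt_nonneg _
  have hbound : ‖rho A a b l‖ ≤ P * η ^ (Fintype.card R - 1) * 2 ^ (Fintype.card R) * E := by
    rw [rho_formula A a b (fun x => Real.sqrt (l x)) l (fun x => Real.sqrt_pos.2 (hl x)) hl]
    have hvol : (volume : Measure (R → ℝ)).real (boxK R) = (2 * Real.pi) ^ (Fintype.card R) := by
      rw [Measure.real, boxK, volume_pi, Measure.pi_pi]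
      simp [ENNReal.toReal_ofReal, Real.pi_pos.le]
    have h1 := norm_setIntegral_le_of_norm_le_const (μ := (volume : Measure (R → ℝ)))
      (s := boxK R) (f := fun θ => (NN A (fun x => Real.sqrt (l x)) a b θ).det *
        Complex.exp (∑ x, (l x : ℂ) * VV A (fun x => Real.sqrt (l x)) x θ))
      (C := P * η ^ (Fintype.card R - 1) * 2 ^ (Fintype.card R) * E)
      (boxK_compact R).measure_lt_top (by
        intro θ _
        rw [norm_mul]
        exact mul_le_mul (NN_det_le A a b η hη1 hηr T l hl hlT' θ)
          (exp_norm_le A hA_offdiag l hl θ) (norm_nonneg _) (by positivity))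
    rw [hvol] at h1
    have h2 : ‖((2 * Real.pi : ℂ) ^ (Fintype.card R))⁻¹‖ =
        ((2 * Real.pi) ^ (Fintype.card R))⁻¹ := by
      simp [abs_of_pos Real.pi_pos]
    rw [norm_mul, h2, inv_mul_le_iff₀ (by positivity)]
    linarith
  refine (Complex.re_le_norm _).trans (hbound.trans ?_)
  have h2 : (2:ℝ) ^ (Fintype.card R) ≤
      Real.exp ((Fintype.card R : ℝ) * (1 + (4 * η * T)⁻¹)) := by
    have h3 : (2:ℝ) ≤ Real.exp 1 := by
      have := Real.add_one_le_exp (1:ℝ)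
      linarith
    calc (2:ℝ) ^ (Fintype.card R) ≤ (Real.exp 1) ^ (Fintype.card R) := by gcongr
      _ = Real.exp ((Fintype.card R : ℝ) * 1) := by rw [← Real.exp_nat_mul]
      _ ≤ _ := by
        apply Real.exp_le_exp.2
        have : 0 ≤ (4 * η * T)⁻¹ := by positivity
        gcongr
        linarith
  have h4 : 0 ≤ E * P * η ^ (Fintype.card R - 1) := by positivity
  calc P * η ^ (Fintype.card R - 1) * 2 ^ (Fintype.card R) * E
      = E * P * η ^ (Fintype.card R - 1) * 2 ^ (Fintype.card R) := by ring
    _ ≤ _ := mul_le_mul_of_nonneg_left h2 h4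

end
end

section
/- Let Λ be a nonempty finite set and let A be a symmetric real Λ×Λ matrix with A_{x,y} ≥ 0 for all x ≠ y. Let μ : Λ → (0,∞) be a probability vector (Σ_{x∈Λ} μ_x = 1). Then for every g : Λ → (0,∞): −Σ_{x,y∈Λ} (μ_x / g_x) A_{x,y} g_y ≥ −Σ_{x,y∈Λ} √(μ_x) A_{x,y} √(μ_y). Consequently, the infimum of g ↦ −Σ_{x,y∈Λ} (μ_x / g_x) A_{x,y} g_y over all g : Λ → (0,∞) is attained at g = √μ, and I_A(μ) := −inf_g Σ_{x,y} (μ_x / g_x) A_{x,y} g_y · (−1)... equals Σ_{x,y∈Λ} √(μ_x) (−A_{x,y}) √(μ_y); that is, the Donsker–Varadhan rate function I_A(μ) = −inf{⟨Ag, μ/g⟩ : g : Λ → (0,∞)} coincides with the Dirichlet form Σ_{x,y∈Λ} √(μ_x)(−A_{x,y})√(μ_y). -/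
open Finset

/-- **Donsker–Varadhan rate function for symmetric generators (remark below (1.4)).**
For a symmetric real matrix `A` with nonnegative off-diagonal entries and a strictly
positive probability vector `μ`, the value `Σ_{x,y} √μ_x A_{x,y} √μ_y` is a lower
bound for `Σ_{x,y} (μ_x/g_x) A_{x,y} g_y` over all `g > 0`; the infimum of this
functional is attained at `g = √μ`; and consequently the Donsker–Varadhan rate
function `I_A(μ) = −inf{⟨Ag, μ/g⟩ : g > 0}` equals the Dirichlet form
`Σ_{x,y} √μ_x (−A_{x,y}) √μ_y`. -/
theorem donsker_varadhan_rate_eq_dirichlet_form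
    {Λ : Type*} [Fintype Λ] [Nonempty Λ]
    (A : Matrix Λ Λ ℝ)
    (hA_symm : ∀ x y, A x y = A y x)
    (hA_offdiag : ∀ x y, x ≠ y → 0 ≤ A x y)
    (μ : Λ → ℝ) (hμ_pos : ∀ x, 0 < μ x) (hμ_sum : ∑ x, μ x = 1) :
    (∀ g : Λ → ℝ, (∀ x, 0 < g x) →
      ∑ x, ∑ y, Real.sqrt (μ x) * A x y * Real.sqrt (μ y) ≤
        ∑ x, ∑ y, (μ x / g x) * A x y * g y) ∧
    IsLeast {r : ℝ | ∃ g : Λ → ℝ, (∀ x, 0 < g x) ∧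
        r = ∑ x, ∑ y, (μ x / g x) * A x y * g y}
      (∑ x, ∑ y, Real.sqrt (μ x) * A x y * Real.sqrt (μ y)) ∧
    -sInf {r : ℝ | ∃ g : Λ → ℝ, (∀ x, 0 < g x) ∧
        r = ∑ x, ∑ y, (μ x / g x) * A x y * g y}
      = ∑ x, ∑ y, Real.sqrt (μ x) * (-(A x y)) * Real.sqrt (μ y) := by
  have key : ∀ g : Λ → ℝ, (∀ x, 0 < g x) →
      ∑ x, ∑ y, Real.sqrt (μ x) * A x y * Real.sqrt (μ y) ≤
        ∑ x, ∑ y, (μ x / g x) * A x y * g y := by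
    intro g hg
    have hswap : ∑ x, ∑ y, (μ x / g x) * A x y * g y
        = ∑ x, ∑ y, (μ y / g y) * A y x * g x := Finset.sum_comm
    have hle : ∑ x, ∑ y, 2 * (Real.sqrt (μ x) * A x y * Real.sqrt (μ y)) ≤
        ∑ x, ∑ y, ((μ x / g x) * A x y * g y + (μ y / g y) * A y x * g x) := by
      refine Finset.sum_le_sum fun x _ => Finset.sum_le_sum fun y _ => ?_
      have hx := hg x
      have hy := hg y
      have hsx := Real.sq_sqrt (hμ_pos x).le
      have hsy := Real.sq_sqrt (hμ_pos y).le
      have hid : (μ x / g x) * A x y * g y + (μ y / g y) * A y x * g x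
          - 2 * (Real.sqrt (μ x) * A x y * Real.sqrt (μ y))
          = A x y * ((Real.sqrt (μ x) * g y - Real.sqrt (μ y) * g x) ^ 2 / (g x * g y)) := by
        rw [hA_symm y x]
        nth_rewrite 1 [← hsx]
        nth_rewrite 1 [← hsy]
        field_simp
        ring
      have hnn : 0 ≤ A x y *
          ((Real.sqrt (μ x) * g y - Real.sqrt (μ y) * g x) ^ 2 / (g x * g y)) := by
        by_cases hxy : x = y
        · subst hxy
          simp
        · have := hA_offdiag x y hxy
          positivity
      linarith
    simp only [Finset.sum_add_distrib, ← Finset.mul_sum] at hle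
    linarith
  have hleast : IsLeast {r : ℝ | ∃ g : Λ → ℝ, (∀ x, 0 < g x) ∧
        r = ∑ x, ∑ y, (μ x / g x) * A x y * g y}
      (∑ x, ∑ y, Real.sqrt (μ x) * A x y * Real.sqrt (μ y)) := by
    refine ⟨⟨fun x => Real.sqrt (μ x), fun x => Real.sqrt_pos.2 (hμ_pos x), ?_⟩, ?_⟩
    · simp only [Real.div_sqrt]
    · rintro r ⟨g, hg, rfl⟩
      exact key g hg
  refine ⟨key, hleast, ?_⟩
  rw [hleast.csInf_eq]
  simp only [mul_neg, neg_mul, Finset.sum_neg_distrib]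
end
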